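/- arXiv:2302.08033 — 2 statements merged into one kernel-verified Lean document; each statement's English description precedes it below -/
import Mathlib

section
/- Discrete velocity ℓ²-stability: there exists a constant C > 0, independent of N, such that for every integer N ≥ 2, if (e¹, e², e_p) ∈ V_h^(1) × V_h^(2) × M_h satisfies the discrete Stokes system with residuals (R¹, R², R), then ‖e‖ ≤ C ( ‖R¹‖_{V¹} + ‖R²‖_{V²} + ‖R‖_{M} ), where e = (e¹, e²) and ‖e‖² = ‖e¹‖²_{V¹} + ‖e²‖²_{V²}. -/
open Finset

noncomputable section

/-- mesh size `h = 1/N` -/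
def gh (N : ℕ) : ℝ := 1 / (N : ℝ)

/-- weights `ρ_0 = ρ_N = 1/2`, `ρ_k = 1` otherwise -/
def rho (N k : ℕ) : ℝ := if k = 0 ∨ k = N then 1/2 else 1

/-- membership in `V_h^(1)`: `v i j` denotes `v_{i, j-1/2}` for `0 ≤ i ≤ N`, `0 ≤ j ≤ N+1`
(index `j` corresponds to the half-integer ordinate `j - 1/2`). -/
def inV1 (N : ℕ) (v : ℕ → ℕ → ℝ) : Prop :=
  (∀ j, v 0 j = 0) ∧ (∀ j, v N j = 0) ∧
  (∀ i, v i 0 = - v i 1) ∧ (∀ i, v i (N+1) = - v i N)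

/-- membership in `V_h^(2)`: `v i j` denotes `v_{i-1/2, j}` for `0 ≤ i ≤ N+1`, `0 ≤ j ≤ N`. -/
def inV2 (N : ℕ) (v : ℕ → ℕ → ℝ) : Prop :=
  (∀ i, v i 0 = 0) ∧ (∀ i, v i N = 0) ∧
  (∀ j, v 0 j = - v 1 j) ∧ (∀ j, v (N+1) j = - v N j)

/-- membership in `M_h`: `q i j` denotes `q_{i-1/2, j-1/2}` for `1 ≤ i, j ≤ N`, discrete mean zero. -/
def inM (N : ℕ) (q : ℕ → ℕ → ℝ) : Prop :=
  ∑ i ∈ Icc 1 N, ∑ j ∈ Icc 1 N, q i j = 0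

/-- `(·,·)_{M_h}` inner product (cell centers `1 ≤ i, j ≤ N`). -/
def innerM (N : ℕ) (q r : ℕ → ℕ → ℝ) : ℝ :=
  gh N ^ 2 * ∑ i ∈ Icc 1 N, ∑ j ∈ Icc 1 N, q i j * r i j

/-- `(·,·)_{V_h^(1)}` inner product (nodes `(i, j-1/2)`, `1 ≤ i ≤ N-1`, `1 ≤ j ≤ N`). -/
def innerV1 (N : ℕ) (v w : ℕ → ℕ → ℝ) : ℝ :=
  gh N ^ 2 * ∑ i ∈ Icc 1 (N-1), ∑ j ∈ Icc 1 N, v i j * w i j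

/-- `(·,·)_{V_h^(2)}` inner product (nodes `(i-1/2, j)`, `1 ≤ i ≤ N`, `1 ≤ j ≤ N-1`). -/
def innerV2 (N : ℕ) (v w : ℕ → ℕ → ℝ) : ℝ :=
  gh N ^ 2 * ∑ i ∈ Icc 1 N, ∑ j ∈ Icc 1 (N-1), v i j * w i j

/-- `(·,·)_{W_h^(1)}` inner product (vertices `1 ≤ i ≤ N-1`, `0 ≤ j ≤ N`, weights `ρ_j`). -/
def innerW1 (N : ℕ) (v w : ℕ → ℕ → ℝ) : ℝ :=
  gh N ^ 2 * ∑ i ∈ Icc 1 (N-1), ∑ j ∈ Icc 0 N, rho N j * (v i j * w i j)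

/-- `(·,·)_{W_h^(2)}` inner product (vertices `0 ≤ i ≤ N`, `1 ≤ j ≤ N-1`, weights `ρ_i`). -/
def innerW2 (N : ℕ) (v w : ℕ → ℕ → ℝ) : ℝ :=
  gh N ^ 2 * ∑ i ∈ Icc 0 N, ∑ j ∈ Icc 1 (N-1), rho N i * (v i j * w i j)

/-- `δ⁻₁` of a `V_h^(1)` function, evaluated at the cell center `(i-1/2, j-1/2)`. -/
def d1V1 (N : ℕ) (v : ℕ → ℕ → ℝ) : ℕ → ℕ → ℝ := fun i j => (v i j - v (i-1) j) / gh N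

/-- `δ⁻₂` of a `V_h^(1)` function, evaluated at the vertex `(i, j)`. -/
def d2V1 (N : ℕ) (v : ℕ → ℕ → ℝ) : ℕ → ℕ → ℝ := fun i j => (v i (j+1) - v i j) / gh N

/-- `δ⁻₁` of a `V_h^(2)` function, evaluated at the vertex `(i, j)`. -/
def d1V2 (N : ℕ) (v : ℕ → ℕ → ℝ) : ℕ → ℕ → ℝ := fun i j => (v (i+1) j - v i j) / gh N

/-- `δ⁻₂` of a `V_h^(2)` function, evaluated at the cell center `(i-1/2, j-1/2)`. -/
def d2V2 (N : ℕ) (v : ℕ → ℕ → ℝ) : ℕ → ℕ → ℝ := fun i j => (v i j - v i (j-1)) / gh N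

/-- `δ⁺₁` of a cell-centered function, evaluated at the node `(i, j-1/2)`. -/
def d1pM (N : ℕ) (q : ℕ → ℕ → ℝ) : ℕ → ℕ → ℝ := fun i j => (q (i+1) j - q i j) / gh N

/-- `δ⁺₂` of a cell-centered function, evaluated at the node `(i-1/2, j)`. -/
def d2pM (N : ℕ) (q : ℕ → ℕ → ℝ) : ℕ → ℕ → ℝ := fun i j => (q i (j+1) - q i j) / gh N

/-- the five-point discrete Laplacian `Δ_h = δ⁺₁δ⁻₁ + δ⁺₂δ⁻₂`. -/
def lap (N : ℕ) (v : ℕ → ℕ → ℝ) : ℕ → ℕ → ℝ := fun i j =>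
  (v (i+1) j - 2 * v i j + v (i-1) j) / gh N ^ 2
    + (v i (j+1) - 2 * v i j + v i (j-1)) / gh N ^ 2

/-- squared discrete `H¹` seminorm
`|v|₁² = ‖δ⁻₁v¹‖²_M + ‖δ⁻₂v¹‖²_{W¹} + ‖δ⁻₁v²‖²_{W²} + ‖δ⁻₂v²‖²_M`. -/
def H1semisq (N : ℕ) (v1 v2 : ℕ → ℕ → ℝ) : ℝ :=
  innerM N (d1V1 N v1) (d1V1 N v1) + innerW1 N (d2V1 N v1) (d2V1 N v1)
    + innerW2 N (d1V2 N v2) (d1V2 N v2) + innerM N (d2V2 N v2) (d2V2 N v2)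

/-- discrete `H¹` seminorm `|v|₁`. -/
def H1semi (N : ℕ) (v1 v2 : ℕ → ℕ → ℝ) : ℝ := Real.sqrt (H1semisq N v1 v2)

/-- `(e¹, e², e_p)` satisfies the discrete MAC Stokes system with residuals `(R¹, R², R)`. -/
def StokesSys (N : ℕ) (e1 e2 ep R1 R2 R : ℕ → ℕ → ℝ) : Prop :=
  (∀ i ∈ Icc 1 (N-1), ∀ j ∈ Icc 1 N, -lap N e1 i j + d1pM N ep i j = R1 i j) ∧
  (∀ i ∈ Icc 1 N, ∀ j ∈ Icc 1 (N-1), -lap N e2 i j + d2pM N ep i j = R2 i j) ∧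
  (∀ i ∈ Icc 1 N, ∀ j ∈ Icc 1 N, d1V1 N e1 i j + d2V2 N e2 i j = R i j)


lemma sbp_gen (g u : ℕ → ℝ) (m : ℕ) :
    ∑ j ∈ range (m+1), g j * (u (j+1) - u j)
      = ∑ j ∈ range m, (g j - g (j+1)) * u (j+1) + g m * u (m+1) - g 0 * u 0 := by
  induction m with
  | zero => simp; ring
  | succ m ih => rw [sum_range_succ, ih, sum_range_succ _ m]; ring

lemma sbp (g u : ℕ → ℝ) (n : ℕ) (h0 : u 0 = 0) (h1 : u (n+1) = 0) :
    ∑ j ∈ range (n+1), g j * (u (j+1) - u j) = ∑ j ∈ range n, (g j - g (j+1)) * u (j+1) := by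
  rw [sbp_gen, h0, h1]; ring

lemma dir_energy (u : ℕ → ℝ) (n : ℕ) (h0 : u 0 = 0) (h1 : u (n+1) = 0) :
    ∑ j ∈ range (n+1), (u (j+1) - u j)^2
      = ∑ j ∈ range n, -(u (j+2) - 2 * u (j+1) + u j) * u (j+1) := by
  have := sbp (fun j => u (j+1) - u j) u n h0 h1
  simp only [← sq] at this
  rw [this]
  exact sum_congr rfl fun j _ => by ring

lemma refl_gen (u : ℕ → ℝ) (m : ℕ) :
    ∑ j ∈ range m, -(u (j+2) - 2 * u (j+1) + u j) * u (j+1)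
      = ∑ j ∈ range m, (u (j+1) - u j)^2 + (u 1 - u 0) * u 0 - (u (m+1) - u m) * u m := by
  induction m with
  | zero => simp
  | succ m ih => rw [sum_range_succ, ih, sum_range_succ _ m]; ring

lemma refl_energy (u : ℕ → ℝ) (n : ℕ) (h0 : u 0 = - u 1) (h1 : u (n+2) = - u (n+1)) :
    1/2 * ∑ j ∈ range (n+2), (u (j+1) - u j)^2
      ≤ ∑ j ∈ range (n+1), -(u (j+2) - 2 * u (j+1) + u j) * u (j+1) := by
  rw [refl_gen, sum_range_succ _ (n+1), sum_range_succ']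
  have : 0 ≤ ∑ j ∈ range n, (u (j+1+1) - u (j+1))^2 := sum_nonneg fun _ _ => sq_nonneg _
  simp only [zero_add, show n+1+1 = n+2 from rfl, h0, h1]
  nlinarith

lemma diff_sq (u : ℕ → ℝ) (i k : ℕ) (h : i ≤ k) :
    (u k - u i)^2 ≤ (k - i : ℝ) * ∑ l ∈ Ico i k, (u (l+1) - u l)^2 := by
  rw [← sum_Ico_sub u h]
  refine (sq_sum_le_card_mul_sum_sq).trans ?_
  rw [Nat.card_Ico, Nat.cast_sub h]

lemma poinc1 (u : ℕ → ℝ) (n : ℕ) (h0 : u 0 = 0) :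
    ∑ j ∈ range n, (u (j+1))^2 ≤ ((n:ℝ)+1)^2 * ∑ j ∈ range (n+1), (u (j+1) - u j)^2 := by
  set S := ∑ j ∈ range (n+1), (u (j+1) - u j)^2 with hS
  have hS0 : 0 ≤ S := sum_nonneg fun _ _ => sq_nonneg _
  have : ∀ j ∈ range n, (u (j+1))^2 ≤ ((n:ℝ)+1) * S := by
    intro j hj
    have hj' : (j:ℝ) < n := by exact_mod_cast mem_range.1 hj
    have h := diff_sq u 0 (j+1) (by omega)
    rw [h0, sub_zero] at h
    have h2 : ∑ l ∈ Ico 0 (j+1), (u (l+1) - u l)^2 ≤ S := by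
      apply sum_le_sum_of_subset_of_nonneg
      · intro l hl; simp at hl hj ⊢; omega
      · intros; positivity
    refine h.trans ?_
    push_cast
    have h3 : 0 ≤ ∑ l ∈ Ico 0 (j+1), (u (l+1) - u l)^2 := sum_nonneg fun _ _ => sq_nonneg _
    apply mul_le_mul (by linarith) h2 h3 (by positivity)
  refine (sum_le_sum this).trans ?_
  simp only [sum_const, card_range, nsmul_eq_mul]
  have : 0 ≤ (n:ℝ) := by positivity
  nlinarith [mul_nonneg this hS0]

/-- distance to the boundary of `[0,N]²` -/
def dd (N x y : ℝ) : ℝ := N/2 - max |x - N/2| |y - N/2|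

lemma dd_symm (N x y : ℝ) : dd N x y = dd N y x := by
  unfold dd; rw [max_comm]

lemma key_max (s t : ℝ) (h : |s| = |t| ∨ |t| + 1 ≤ |s| ∨ |s| + 1 ≤ |t|)
    (hs : s = 0 ∨ 1/2 ≤ |s|) (ht : t = 0 ∨ 1/2 ≤ |t|) :
    max |s| |t| ≤ s * (max |s+1/2| |t| - max |s-1/2| |t|)
      + t * (max |s| |t+1/2| - max |s| |t-1/2|) := by
  have A : ∀ s t : ℝ, |t| + 1 ≤ |s| → max |s| |t| ≤ s * (max |s+1/2| |t| - max |s-1/2| |t|)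
      + t * (max |s| |t+1/2| - max |s| |t-1/2|) := by
    intro s t h
    have h1 : |t+1/2| ≤ |s| := (abs_add_le _ _).trans (by norm_num; linarith)
    have h2 : |t-1/2| ≤ |s| := (abs_sub _ _).trans (by norm_num; linarith)
    have h0 := abs_nonneg t
    rw [max_eq_left h1, max_eq_left h2, max_eq_left (by linarith)]
    rcases le_total 0 s with hs | hs
    · rw [abs_of_nonneg hs] at *
      rw [abs_of_nonneg (show 0 ≤ s+1/2 by linarith), abs_of_nonneg (show 0 ≤ s-1/2 by linarith),
        max_eq_left (by linarith), max_eq_left (by linarith)]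
      apply le_of_eq; ring
    · rw [abs_of_nonpos hs] at *
      rw [abs_of_nonpos (show s+1/2 ≤ 0 by linarith), abs_of_nonpos (show s-1/2 ≤ 0 by linarith),
        max_eq_left (by linarith), max_eq_left (by linarith)]
      apply le_of_eq; ring
  rcases h with h | h | h
  · have B : ∀ s r : ℝ, r = |s| → (s = 0 ∨ 1/2 ≤ |s|) →
        |s| / 2 ≤ s * (max |s+1/2| r - max |s-1/2| r) := by
      rintro s r rfl hs
      rcases hs with rfl | hs
      · simp
      rcases le_total 0 s with h0 | h0
      · rw [abs_of_nonneg h0] at *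
        rw [abs_of_nonneg (show 0 ≤ s+1/2 by linarith), abs_of_nonneg (show 0 ≤ s-1/2 by linarith),
          max_eq_left (by linarith), max_eq_right (by linarith)]
        apply le_of_eq; ring
      · rw [abs_of_nonpos h0] at *
        rw [abs_of_nonpos (show s+1/2 ≤ 0 by linarith), abs_of_nonpos (show s-1/2 ≤ 0 by linarith),
          max_eq_right (by linarith), max_eq_left (by linarith)]
        apply le_of_eq; ring
    have h1 := B s |t| h.symm hs
    have h2 := B t |s| h ht
    rw [max_comm |s| |t+1/2|, max_comm |s| |t-1/2|, h, max_self]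
    rw [h] at h1 h2
    linarith
  · exact A s t h
  · have := A t s h
    rw [max_comm |s| |t|, max_comm |s| |t+1/2|, max_comm |s| |t-1/2|,
      max_comm |s+1/2|, max_comm |s-1/2|]
    linarith

lemma max_convex (s t : ℝ) : 2 * max |s| |t| ≤ max |s+1/2| |t| + max |s-1/2| |t| := by
  have h1 := le_max_left |s+1/2| |t|
  have h2 := le_max_right |s+1/2| |t|
  have h3 := le_max_left |s-1/2| |t|
  have h4 := le_max_right |s-1/2| |t|
  have h5 : 2 * |s| ≤ |s+1/2| + |s-1/2| := by
    have := abs_add_le (s+1/2) (s-1/2)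
    rw [show s+1/2+(s-1/2) = 2*s by ring, abs_mul] at this
    simpa using this
  rcases max_cases |s| |t| with h | h <;> rw [h.1] <;> linarith

lemma cell_div (n i j : ℕ) (N : ℝ) (hN : N = n + 1) :
    3 * max |(i:ℝ) + 1/2 - N/2| |(j:ℝ) + 1/2 - N/2| - N ≤
      (-(((i:ℝ)+1 - N/2) * dd N (i+1) (j+1/2)) - -(((i:ℝ) - N/2) * dd N i (j+1/2)))
      + (-(((j:ℝ)+1 - N/2) * dd N (j+1) (i+1/2)) - -(((j:ℝ) - N/2) * dd N j (i+1/2))) := by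
  set s := (i:ℝ) + 1/2 - N/2 with hs
  set t := (j:ℝ) + 1/2 - N/2 with ht
  have es : (i:ℝ) - N/2 = s - 1/2 := by rw [hs]; ring
  have es' : (i:ℝ) + 1 - N/2 = s + 1/2 := by rw [hs]; ring
  have et : (j:ℝ) - N/2 = t - 1/2 := by rw [ht]; ring
  have et' : (j:ℝ) + 1 - N/2 = t + 1/2 := by rw [ht]; ring
  simp only [dd, es, es', et, et', ← hs, ← ht]
  have sa : s = ((2 * i - n : ℤ) : ℝ) / 2 := by rw [hs, hN]; push_cast; ring
  have ta : t = ((2 * j - n : ℤ) : ℝ) / 2 := by rw [ht, hN]; push_cast; ring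
  have k := key_max s t (by
    rw [sa, ta, abs_div, abs_div, ← Int.cast_abs, ← Int.cast_abs]
    have : |(2 * i - n : ℤ)| = |(2 * j - n : ℤ)| ∨ |(2 * j - n : ℤ)| + 2 ≤ |(2 * i - n : ℤ)|
        ∨ |(2 * i - n : ℤ)| + 2 ≤ |(2 * j - n : ℤ)| := by
      rcases abs_cases (2 * i - n : ℤ) with h | h <;> rcases abs_cases (2 * j - n : ℤ) with h' | h' <;>
        rw [h.1, h'.1] <;> omega
    rcases this with h | h | h
    · left; rw [h]
    · right; left
      have : ((|(2 * j - n : ℤ)| + 2 : ℤ) : ℝ) ≤ (|(2 * i - n : ℤ)| : ℤ) := by exact_mod_cast h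
      rw [Int.cast_add] at this
      norm_num at this ⊢
      linarith
    · right; right
      have : ((|(2 * i - n : ℤ)| + 2 : ℤ) : ℝ) ≤ (|(2 * j - n : ℤ)| : ℤ) := by exact_mod_cast h
      rw [Int.cast_add] at this
      norm_num at this ⊢
      linarith) (by
    rw [sa]
    rcases eq_or_ne (2 * i - n : ℤ) 0 with h | h
    · left; rw [h]; simp
    · right
      have : (1:ℝ) ≤ |((2 * i - n : ℤ):ℝ)| := by exact_mod_cast Int.one_le_abs h
      rw [abs_div, abs_two]; linarith) (by
    rw [ta]
    rcases eq_or_ne (2 * j - n : ℤ) 0 with h | h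
    · left; rw [h]; simp
    · right
      have : (1:ℝ) ≤ |((2 * j - n : ℤ):ℝ)| := by exact_mod_cast Int.one_le_abs h
      rw [abs_div, abs_two]; linarith)
  have c1 := max_convex s t
  have c2 := max_convex t s
  rw [max_comm |s| |t+1/2|, max_comm |s| |t-1/2|] at k
  rw [max_comm |t| |s|] at c2
  nlinarith

lemma dd_zero (N y : ℝ) (hN : 0 ≤ N) (hy : |y - N/2| ≤ N/2) : dd N 0 y = 0 := by
  unfold dd
  rw [zero_sub, abs_neg, abs_of_nonneg (by linarith), max_eq_left hy]; ring

lemma dd_N (N y : ℝ) (hN : 0 ≤ N) (hy : |y - N/2| ≤ N/2) : dd N N y = 0 := by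
  unfold dd
  rw [show N - N/2 = N/2 by ring, abs_of_nonneg (by linarith), max_eq_left hy]; ring

lemma dd_nonneg (N x y : ℝ) (hx : |x - N/2| ≤ N/2) (hy : |y - N/2| ≤ N/2) : 0 ≤ dd N x y := by
  unfold dd
  have := max_le hx hy
  linarith

lemma half_le (n j : ℕ) (hj : j ≤ n) (N : ℝ) (hN : N = n+1) : |(j:ℝ) + 1/2 - N/2| ≤ N/2 := by
  have : (j:ℝ) ≤ n := by exact_mod_cast hj
  have h0 : (0:ℝ) ≤ j := by positivity
  rw [abs_le]; constructor <;> linarith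

lemma int_le (n j : ℕ) (hj : j ≤ n + 1) (N : ℝ) (hN : N = n+1) : |(j:ℝ) - N/2| ≤ N/2 := by
  have : (j:ℝ) ≤ n + 1 := by exact_mod_cast hj
  have h0 : (0:ℝ) ≤ j := by positivity
  rw [abs_le]; constructor <;> linarith

lemma row_bound (n : ℕ) (N y : ℝ) (hN : N = n+1) (hy : |y - N/2| ≤ N/2) (u : ℕ → ℝ) :
    ∑ i ∈ range (n+1), (u i)^2 *
        (-(((i:ℝ)+1 - N/2) * dd N (i+1) y) - -(((i:ℝ) - N/2) * dd N i y))
      ≤ 8 * N * ∑ i ∈ range n, (dd N (i+1) y)^2 * (u (i+1) - u i)^2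
        + N / 32 * ∑ i ∈ range (n+1), (u i)^2 := by
  have hN0 : 0 ≤ N := by rw [hN]; positivity
  have h := sbp (fun i => (u i)^2) (fun i => -(((i:ℝ) - N/2) * dd N i y)) n
    (by simp [dd_zero N y hN0 hy]) (by
      have : ((n+1 : ℕ) : ℝ) = N := by rw [hN]; push_cast; ring
      simp only [this, dd_N N y hN0 hy]; ring)
  simp only [Nat.cast_add, Nat.cast_one] at h
  rw [h]
  have h1 : ∀ i ∈ range n, ((u i)^2 - (u (i+1))^2) * -(((i:ℝ) + 1 - N/2) * dd N (i+1) y)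
      ≤ 8 * N * ((dd N (i+1) y)^2 * (u (i+1) - u i)^2) + N/64 * ((u i)^2 + (u (i+1))^2) := by
    intro i hi
    have hi' := mem_range.1 hi
    have hx := int_le n (i+1) (by omega) N hN
    push_cast at hx
    set d := dd N (i+1) y
    set x := (i:ℝ) + 1 - N/2
    have hx2 : x^2 ≤ (N/2)^2 := sq_le_sq' (abs_le.1 hx).1 (abs_le.1 hx).2
    rcases eq_or_lt_of_le hN0 with h0 | h0
    · rw [← h0] at hx2
      have : x = 0 := by nlinarith
      rw [this, ← h0]; simp
    set a := d * (u (i+1) - u i)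
    have e1 : (u i ^ 2 - u (i+1)^2) * -(x * d) = x * a * (u i + u (i+1)) := by simp only [a]; ring
    have e2 : 8 * N * (d^2 * (u (i+1) - u i)^2) = 8 * N * a^2 := by simp only [a]; ring
    rw [e1, e2]
    have e3 : x * a * (u i + u (i+1)) ≤ N/2 * |a| * |u i + u (i+1)| := by
      refine (le_abs_self _).trans ?_
      rw [abs_mul, abs_mul]
      gcongr
    have e4 : |a| * |u i + u (i+1)| ≤ 16 * a^2 + 1/64 * (u i + u (i+1))^2 := by
      rw [← sq_abs a, ← sq_abs (u i + u (i+1))]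
      nlinarith [sq_nonneg (4 * |a| - 1/8 * |u i + u (i+1)|)]
    have e5 : (u i + u (i+1))^2 ≤ 2 * ((u i)^2 + (u (i+1))^2) := by
      nlinarith [sq_nonneg (u i - u (i+1))]
    have e6 : |a| * |u i + u (i+1)| ≤ 16 * a^2 + 1/32 * ((u i)^2 + (u (i+1))^2) := by linarith
    have := mul_le_mul_of_nonneg_left e6 (show 0 ≤ N/2 by linarith)
    linarith
  refine (sum_le_sum h1).trans ?_
  rw [sum_add_distrib, ← mul_sum, ← mul_sum, sum_add_distrib]
  have a1 : ∑ i ∈ range n, (u i)^2 ≤ ∑ i ∈ range (n+1), (u i)^2 := by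
    rw [sum_range_succ]; nlinarith [sq_nonneg (u n)]
  have a2 : ∑ i ∈ range n, (u (i+1))^2 ≤ ∑ i ∈ range (n+1), (u i)^2 := by
    rw [sum_range_succ']; nlinarith [sq_nonneg (u 0)]
  nlinarith

/-- inner index set -/
def inn (n : ℕ) (N : ℝ) : Finset ℕ :=
  (range (n+1)).filter fun i => |(i:ℝ) + 1/2 - N/2| < 3 * N / 8

/-- weighted gradient -/
def Bsum (n : ℕ) (N : ℝ) (p : ℕ → ℕ → ℝ) : ℝ :=
  ∑ j ∈ range (n+1), ∑ i ∈ range n, (dd N (i+1) (j+1/2))^2 * (p (i+1) j - p i j)^2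
  + ∑ i ∈ range (n+1), ∑ j ∈ range n, (dd N (j+1) (i+1/2))^2 * (p i (j+1) - p i j)^2

lemma outer_bound (n : ℕ) (N : ℝ) (hN : N = n+1) (q : ℕ → ℕ → ℝ) :
    ∑ i ∈ range (n+1), ∑ j ∈ range (n+1), (q i j)^2
      ≤ 128 * Bsum n N q + 18 * ∑ i ∈ inn n N, ∑ j ∈ inn n N, (q i j)^2 := by
  have hN0 : 0 < N := by rw [hN]; positivity
  set Q := ∑ i ∈ range (n+1), ∑ j ∈ range (n+1), (q i j)^2 with hQ
  have hQ' : Q = ∑ j ∈ range (n+1), ∑ i ∈ range (n+1), (q i j)^2 := by rw [hQ, sum_comm]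
  have h1 := sum_le_sum fun j (hj : j ∈ range (n+1)) =>
    row_bound n N (j+1/2) hN (half_le n j (by simp at hj; omega) N hN) (fun i => q i j)
  have h2 := sum_le_sum fun i (hi : i ∈ range (n+1)) =>
    row_bound n N (i+1/2) hN (half_le n i (by simp at hi; omega) N hN) (fun j => q i j)
  rw [sum_add_distrib, ← mul_sum, ← mul_sum, ← hQ'] at h1
  rw [sum_add_distrib, ← mul_sum, ← mul_sum, ← hQ] at h2
  rw [sum_comm] at h1
  have h3 := add_le_add h1 h2
  rw [← sum_add_distrib] at h3
  simp only [← sum_add_distrib] at h3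
  have hin : ∑ i ∈ inn n N, ∑ j ∈ inn n N, (q i j)^2
     = ∑ i ∈ range (n+1), ∑ j ∈ range (n+1),
       if i ∈ inn n N ∧ j ∈ inn n N then (q i j)^2 else 0 := by
    have hs : ∀ f : ℕ → ℝ, ∑ i ∈ inn n N, f i = ∑ i ∈ range (n+1), if i ∈ inn n N then f i else 0 := by
      intro f
      rw [← sum_filter]
      congr 1
      ext i; simp [inn]
    rw [hs]
    refine sum_congr rfl fun i _ => ?_
    rw [hs]
    split_ifs with h <;> simp [h]
  have h4 : N/8 * Q ≤ ∑ i ∈ range (n+1), ∑ j ∈ range (n+1), ((q i j)^2 *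
        (-(((i:ℝ)+1 - N/2) * dd N (i+1) (j+1/2)) - -(((i:ℝ) - N/2) * dd N i (j+1/2)))
      + (q i j)^2 *
        (-(((j:ℝ)+1 - N/2) * dd N (j+1) (i+1/2)) - -(((j:ℝ) - N/2) * dd N j (i+1/2))))
      + 9/8 * N * ∑ i ∈ inn n N, ∑ j ∈ inn n N, (q i j)^2 := by
    rw [hin, hQ, mul_sum, mul_sum, ← sum_add_distrib]
    refine sum_le_sum fun i hi => ?_
    rw [mul_sum, mul_sum, ← sum_add_distrib]
    refine sum_le_sum fun j hj => ?_
    have hc := cell_div n i j N hN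
    rw [← mul_add]
    have hq := sq_nonneg (q i j)
    have hc2 := mul_le_mul_of_nonneg_left hc hq
    refine le_trans ?_ (add_le_add_left hc2 _)
    split_ifs with h
    · have : 0 ≤ max |(i:ℝ) + 1/2 - N/2| |(j:ℝ) + 1/2 - N/2| := le_max_of_le_left (abs_nonneg _)
      nlinarith
    · have : 3 * N / 8 ≤ max |(i:ℝ) + 1/2 - N/2| |(j:ℝ) + 1/2 - N/2| := by
        by_contra hlt
        push Not at hlt
        apply h
        simp only [inn, mem_filter]
        exact ⟨⟨hi, (le_max_left _ _).trans_lt hlt⟩, ⟨hj, (le_max_right _ _).trans_lt hlt⟩⟩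
      nlinarith
  have h5 : N * Q ≤ N * (128 * Bsum n N q + 18 * ∑ i ∈ inn n N, ∑ j ∈ inn n N, (q i j)^2) := by
    unfold Bsum
    nlinarith
  exact le_of_mul_le_mul_left h5 hN0

lemma row_inner (n : ℕ) (N y : ℝ) (hN : N = n+1) (hy : |y - N/2| < 3 * N / 8) (u : ℕ → ℝ)
    (i k : ℕ) (hi : i ∈ inn n N) (hk : k ∈ inn n N) :
    N * (u i - u k)^2 ≤ 64 * ∑ l ∈ range n, (dd N (l+1) y)^2 * (u (l+1) - u l)^2 := by
  wlog hik : i ≤ k generalizing i k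
  · have := this k i hk hi (by omega)
    rw [← neg_sub, neg_sq]; exact this
  have hN0 : 0 < N := by rw [hN]; positivity
  simp only [inn, mem_filter, mem_range, abs_lt] at hi hk
  have hkn : (k:ℝ) ≤ n := by exact_mod_cast (by omega : k ≤ n)
  have hi0 : (0:ℝ) ≤ i := by positivity
  have h := diff_sq u i k hik
  have h0 : 0 ≤ ∑ l ∈ Ico i k, (u (l+1) - u l)^2 := sum_nonneg fun _ _ => sq_nonneg _
  have h1 : (u i - u k)^2 ≤ N * ∑ l ∈ Ico i k, (u (l+1) - u l)^2 := by
    rw [← neg_sub, neg_sq]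
    refine h.trans ?_
    apply mul_le_mul_of_nonneg_right _ h0
    linarith
  have h2 : N^2 * ∑ l ∈ Ico i k, (u (l+1) - u l)^2
      ≤ 64 * ∑ l ∈ range n, (dd N (l+1) y)^2 * (u (l+1) - u l)^2 := by
    calc _ = ∑ l ∈ Ico i k, N^2 * (u (l+1) - u l)^2 := by rw [mul_sum]
      _ ≤ ∑ l ∈ Ico i k, 64 * ((dd N (l+1) y)^2 * (u (l+1) - u l)^2) := by
        refine sum_le_sum fun l hl => ?_
        rw [mem_Ico] at hl
        have l1 : (i:ℝ) ≤ l := by exact_mod_cast hl.1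
        have l2 : (l:ℝ) + 1 ≤ k := by exact_mod_cast hl.2
        have hd : N/8 ≤ dd N (l+1) y := by
          unfold dd
          have : max |(l:ℝ)+1-N/2| |y - N/2| ≤ 3*N/8 := by
            apply max_le _ hy.le
            rw [abs_le]; constructor <;> linarith [hi.2.1, hi.2.2, hk.2.1, hk.2.2]
          linarith
        have : N^2 ≤ 64 * (dd N (l+1) y)^2 := by nlinarith
        nlinarith [mul_le_mul_of_nonneg_right this (sq_nonneg (u (l+1) - u l))]
      _ ≤ ∑ l ∈ range n, 64 * ((dd N (l+1) y)^2 * (u (l+1) - u l)^2) := by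
        apply sum_le_sum_of_subset_of_nonneg
        · intro l hl; simp at hl ⊢; omega
        · intros; positivity
      _ = _ := by rw [mul_sum]
  nlinarith

lemma inn_nonempty (n : ℕ) (hn : 1 ≤ n) (N : ℝ) (hN : N = n+1) : (inn n N).Nonempty := by
  refine ⟨n/2, ?_⟩
  simp only [inn, mem_filter, mem_range, abs_lt]
  have h1 : (n:ℝ) ≤ 2 * ((n/2 : ℕ):ℝ) + 1 := by exact_mod_cast (by omega : n ≤ 2 * (n/2) + 1)
  have h2 : 2 * ((n/2 : ℕ):ℝ) ≤ n := by exact_mod_cast (by omega : 2 * (n/2) ≤ n)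
  have h3 : (1:ℝ) ≤ n := by exact_mod_cast hn
  refine ⟨by omega, ?_, ?_⟩ <;> linarith

lemma inner_bound (n : ℕ) (hn : 1 ≤ n) (N : ℝ) (hN : N = n+1) (p : ℕ → ℕ → ℝ) :
    ∃ c, ∑ i ∈ inn n N, ∑ j ∈ inn n N, (p i j - c)^2 ≤ 128 * Bsum n N p := by
  have hN0 : 0 < N := by rw [hN]; positivity
  have hne := inn_nonempty n hn N hN
  set A1 : ℕ → ℝ := fun j =>
    ∑ i ∈ range n, (dd N (i+1) (j+1/2))^2 * (p (i+1) j - p i j)^2 with hA1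
  set A2 : ℕ → ℝ := fun i =>
    ∑ j ∈ range n, (dd N (j+1) (i+1/2))^2 * (p i (j+1) - p i j)^2 with hA2
  have A1n : ∀ j, 0 ≤ A1 j := fun j => sum_nonneg fun _ _ => by positivity
  have A2n : ∀ j, 0 ≤ A2 j := fun j => sum_nonneg fun _ _ => by positivity
  have hB : Bsum n N p = ∑ j ∈ range (n+1), A1 j + ∑ i ∈ range (n+1), A2 i := rfl
  have hsub : inn n N ⊆ range (n+1) := filter_subset _ _
  have s1 : ∑ j ∈ inn n N, A1 j ≤ ∑ j ∈ range (n+1), A1 j :=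
    sum_le_sum_of_subset_of_nonneg hsub fun j _ _ => A1n j
  have s2 : ∑ j ∈ inn n N, A2 j ≤ ∑ j ∈ range (n+1), A2 j :=
    sum_le_sum_of_subset_of_nonneg hsub fun j _ _ => A2n j
  obtain ⟨k, hk, hmin⟩ := exists_min_image (inn n N) A2 hne
  have hav : ((inn n N).card : ℝ) * A2 k ≤ ∑ j ∈ inn n N, A2 j := by
    rw [← nsmul_eq_mul]; exact card_nsmul_le_sum _ _ _ hmin
  have hcard : ((inn n N).card : ℝ) ≤ N := by
    have := card_le_card hsub
    rw [card_range] at this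
    have h2 : ((inn n N).card : ℝ) ≤ ((n+1 : ℕ) : ℝ) := by exact_mod_cast this
    push_cast at h2
    linarith
  have mem : ∀ i ∈ inn n N, |(i:ℝ)+1/2 - N/2| < 3*N/8 := fun i hi => (mem_filter.1 hi).2
  refine ⟨p k k, ?_⟩
  have h1 : ∀ i ∈ inn n N, ∀ j ∈ inn n N, N * (p i j - p k k)^2 ≤ 128 * (A1 j + A2 k) := by
    intro i hi j hj
    have a := row_inner n N (j+1/2) hN (mem j hj) (fun i => p i j) i k hi hk
    have b := row_inner n N (k+1/2) hN (mem k hk) (fun j => p k j) j k hj hk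
    have c : (p i j - p k k)^2 ≤ 2 * (p i j - p k j)^2 + 2 * (p k j - p k k)^2 := by
      nlinarith [sq_nonneg ((p i j - p k j) - (p k j - p k k))]
    simp only [hA1, hA2]
    nlinarith
  have h2 : N * ∑ i ∈ inn n N, ∑ j ∈ inn n N, (p i j - p k k)^2 ≤ N * (128 * Bsum n N p) := by
    rw [mul_sum]
    simp only [mul_sum]
    refine (sum_le_sum fun i hi => sum_le_sum fun j hj => h1 i hi j hj).trans ?_
    simp only [← mul_sum, sum_add_distrib, sum_const, nsmul_eq_mul]
    rw [hB]
    set K := ((inn n N).card : ℝ)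
    have hK : 0 ≤ K := Nat.cast_nonneg _
    have e1 : 0 ≤ ∑ j ∈ inn n N, A1 j := sum_nonneg fun j _ => A1n j
    have e2 : 0 ≤ ∑ j ∈ inn n N, A2 j := sum_nonneg fun j _ => A2n j
    have f1 : K * ∑ j ∈ inn n N, A1 j ≤ N * ∑ j ∈ range (n+1), A1 j :=
      mul_le_mul hcard s1 e1 hN0.le
    have f2 : K * (K * A2 k) ≤ N * ∑ j ∈ range (n+1), A2 j :=
      mul_le_mul hcard (hav.trans s2) (mul_nonneg hK (A2n k)) hN0.le
    linarith
  exact le_of_mul_le_mul_left h2 hN0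

lemma improved_poincare (n : ℕ) (hn : 1 ≤ n) (N : ℝ) (hN : N = n+1) (p : ℕ → ℕ → ℝ) :
    ∃ c, ∑ i ∈ range (n+1), ∑ j ∈ range (n+1), (p i j - c)^2 ≤ 2500 * Bsum n N p := by
  obtain ⟨c, hc⟩ := inner_bound n hn N hN p
  refine ⟨c, ?_⟩
  have h := outer_bound n N hN (fun i j => p i j - c)
  have e : Bsum n N (fun i j => p i j - c) = Bsum n N p := by simp [Bsum]
  rw [e] at h
  have : 0 ≤ Bsum n N p := by
    unfold Bsum
    refine add_nonneg ?_ ?_ <;> exact sum_nonneg fun _ _ => sum_nonneg fun _ _ => by positivity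
  linarith

lemma max_lip (a b c : ℝ) (h : |b - c| ≤ 1/2) : |(max |a| |b|) - (max |a| |c|)| ≤ 1/2 := by
  have A : ∀ b c : ℝ, |b - c| ≤ 1/2 → max |a| |b| ≤ max |a| |c| + 1/2 := by
    intro b c h
    have := abs_sub_abs_le_abs_sub b c
    exact max_le (by linarith [le_max_left |a| |c|]) (by linarith [le_max_right |a| |c|])
  have h1 := A b c h
  have h2 := A c b (by rwa [abs_sub_comm])
  rw [abs_le]; constructor <;> linarith

lemma edge_term (d v1 v0 g w1 w0 : ℝ) (hd : 1/2 ≤ d) (h1 : |d - v1| ≤ 1/2) (h0 : |d - v0| ≤ 1/2) :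
    d^2 * g * (w1 - w0) ≤ g * (v1^2 * w1 - v0^2 * w0) + 1/4 * (d^2 * g^2)
      + 9/2 * (w1^2 + w0^2) := by
  have A : ∀ v : ℝ, |d - v| ≤ 1/2 → (d^2 - v^2)^2 ≤ (3/2 * d)^2 := by
    intro v h
    rw [abs_le] at h
    apply sq_le_sq'
    · nlinarith
    · nlinarith
  have B : ∀ v w : ℝ, |d - v| ≤ 1/2 → (d^2 - v^2) * g * w ≤ 1/8 * (d^2*g^2) + 9/2 * w^2 := by
    intro v w h
    have h3 := mul_le_mul_of_nonneg_right (A v h) (sq_nonneg g)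
    nlinarith [sq_nonneg ((d^2-v^2) * g - 9 * w)]
  have b1 := B v1 w1 h1
  have b0 := B v0 (-w0) h0
  nlinarith

lemma col_bound (n k : ℕ) (hk : k < n) (N : ℝ) (hN : N = n+1) (g w : ℕ → ℝ) :
    ∑ j ∈ range (n+1), (dd N (k+1) (j+1/2))^2 * g j * (w (j+1) - w j)
      ≤ ∑ j ∈ range n, (g j - g (j+1)) * ((dd N (k+1) (j+1))^2 * w (j+1))
        + 1/4 * ∑ j ∈ range (n+1), (dd N (k+1) (j+1/2))^2 * (g j)^2
        + 9 * ∑ j ∈ range (n+2), (w j)^2 := by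
  have hN0 : 0 ≤ N := by rw [hN]; positivity
  have hk1 := int_le n (k+1) (by omega) N hN
  push_cast at hk1
  have h := sbp g (fun j => (dd N (k+1) j)^2 * w j) n
    (by simp only [Nat.cast_zero]; rw [dd_symm, dd_zero N _ hN0 hk1]; ring)
    (by
      have : ((n+1 : ℕ) : ℝ) = N := by rw [hN]; push_cast; ring
      simp only [this]; rw [dd_symm, dd_N N _ hN0 hk1]; ring)
  simp only [Nat.cast_add, Nat.cast_one] at h
  rw [← h]
  have h1 : ∀ j ∈ range (n+1), (dd N (k+1) (j+1/2))^2 * g j * (w (j+1) - w j)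
      ≤ g j * ((dd N (k+1) (j+1))^2 * w (j+1) - (dd N (k+1) j)^2 * w j)
        + 1/4 * ((dd N (k+1) (j+1/2))^2 * (g j)^2) + 9/2 * ((w (j+1))^2 + (w j)^2) := by
    intro j hj
    have hj' : (j:ℝ) ≤ n := by exact_mod_cast Nat.lt_succ_iff.1 (mem_range.1 hj)
    have hk' : (k:ℝ) + 1 ≤ n := by exact_mod_cast hk
    have k0 : (0:ℝ) ≤ k := by positivity
    have j0 : (0:ℝ) ≤ j := by positivity
    apply edge_term
    · unfold dd
      have : max |(k:ℝ)+1-N/2| |(j:ℝ)+1/2-N/2| ≤ N/2-1/2 := by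
        apply max_le <;> rw [abs_le] <;> constructor <;> linarith
      linarith
    · have := max_lip ((k:ℝ)+1-N/2) ((j:ℝ)+1-N/2) ((j:ℝ)+1/2-N/2) (by ring_nf; norm_num)
      unfold dd
      convert this using 2; ring
    · have := max_lip ((k:ℝ)+1-N/2) ((j:ℝ)-N/2) ((j:ℝ)+1/2-N/2) (by ring_nf; norm_num [abs_le])
      unfold dd
      convert this using 2; ring
  refine (sum_le_sum h1).trans ?_
  rw [sum_add_distrib, sum_add_distrib, ← mul_sum, ← mul_sum, sum_add_distrib]
  have a1 : ∑ j ∈ range (n+1), (w j)^2 ≤ ∑ j ∈ range (n+2), (w j)^2 := by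
    rw [sum_range_succ _ (n+1)]; nlinarith [sq_nonneg (w (n+1))]
  have a2 : ∑ j ∈ range (n+1), (w (j+1))^2 ≤ ∑ j ∈ range (n+2), (w j)^2 := by
    rw [sum_range_succ' _ (n+1)]; nlinarith [sq_nonneg (w 0)]
  linarith

lemma src_term (h d g r : ℝ) (hd0 : 0 ≤ d) (h0 : 0 ≤ h) (hd : h * d ≤ 1) :
    d^2 * g * (h * r) ≤ 1/4 * (d^2 * g^2) + r^2 := by
  have h1 : (h*d)^2 ≤ 1 := by
    have := mul_nonneg h0 hd0
    nlinarith
  have h2 := mul_le_mul_of_nonneg_right h1 (sq_nonneg r)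
  nlinarith [sq_nonneg (1/2 * (d * g) - h * d * r)]

lemma dd_le (N x y h : ℝ) (h0 : 0 ≤ h) (hh : h * N = 1) : h * dd N x y ≤ 1 := by
  unfold dd
  have : 0 ≤ max |x - N/2| |y - N/2| := le_max_of_le_left (abs_nonneg _)
  nlinarith [mul_nonneg h0 this]

lemma weighted_grad (n : ℕ) (N h : ℝ) (hN : N = n+1) (h0 : 0 ≤ h) (hh : h * N = 1)
    (p r1 r2 w : ℕ → ℕ → ℝ)
    (e1 : ∀ i < n, ∀ j < n+1, p (i+1) j - p i j = h * r1 i j + (w (i+1) (j+1) - w (i+1) j))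
    (e2 : ∀ i < n+1, ∀ j < n, p i (j+1) - p i j = h * r2 i j - (w (i+1) (j+1) - w i (j+1))) :
    Bsum n N p ≤ 2 * (∑ i ∈ range n, ∑ j ∈ range (n+1), (r1 i j)^2
        + ∑ j ∈ range n, ∑ i ∈ range (n+1), (r2 i j)^2)
      + 18 * (∑ i ∈ range n, ∑ j ∈ range (n+2), (w (i+1) j)^2
        + ∑ j ∈ range n, ∑ i ∈ range (n+2), (w i (j+1))^2) := by
  set B1 := ∑ i ∈ range n, ∑ j ∈ range (n+1),
    (dd N (i+1) (j+1/2))^2 * (p (i+1) j - p i j)^2 with hB1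
  set B2 := ∑ j ∈ range n, ∑ i ∈ range (n+1),
    (dd N (j+1) (i+1/2))^2 * (p i (j+1) - p i j)^2 with hB2
  have hB : Bsum n N p = B1 + B2 := by
    unfold Bsum; rw [sum_comm, ← hB1]; congr 1; rw [sum_comm]
  have nn : ∀ i < n, ∀ j < n+1, 0 ≤ dd N ((i:ℝ)+1) ((j:ℝ)+1/2) := by
    intro i hi j hj
    have := int_le n (i+1) (by omega) N hN
    push_cast at this
    exact dd_nonneg _ _ _ this (half_le n j (by omega) N hN)
  have c1 : ∀ i ∈ range n, 3/4 * ∑ j ∈ range (n+1), (dd N (i+1) (j+1/2))^2 * (p (i+1) j - p i j)^2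
      ≤ ∑ j ∈ range (n+1), (r1 i j)^2
        + ∑ j ∈ range n, ((p (i+1) j - p i j) - (p (i+1) (j+1) - p i (j+1))) *
          ((dd N (i+1) (j+1))^2 * w (i+1) (j+1))
        + 1/4 * ∑ j ∈ range (n+1), (dd N (i+1) (j+1/2))^2 * (p (i+1) j - p i j)^2
        + 9 * ∑ j ∈ range (n+2), (w (i+1) j)^2 := by
    intro i hi
    rw [mem_range] at hi
    have hc := col_bound n i hi N hN (fun j => p (i+1) j - p i j) (fun j => w (i+1) j)
    have hs : ∑ j ∈ range (n+1), (dd N (i+1) (j+1/2))^2 * (p (i+1) j - p i j)^2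
        ≤ ∑ j ∈ range (n+1), (1/4 * ((dd N (i+1) (j+1/2))^2 * (p (i+1) j - p i j)^2) + (r1 i j)^2
          + (dd N (i+1) (j+1/2))^2 * (p (i+1) j - p i j) * (w (i+1) (j+1) - w (i+1) j)) := by
      refine sum_le_sum fun j hj => ?_
      rw [mem_range] at hj
      have := src_term h (dd N (i+1) (j+1/2)) (p (i+1) j - p i j) (r1 i j) (nn i hi j hj) h0
        (dd_le _ _ _ _ h0 hh)
      have e := e1 i hi j hj
      have : (dd N (i+1) (j+1/2))^2 * (p (i+1) j - p i j)^2 =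
        (dd N (i+1) (j+1/2))^2 * (p (i+1) j - p i j) * (h * r1 i j) +
        (dd N (i+1) (j+1/2))^2 * (p (i+1) j - p i j) * (w (i+1) (j+1) - w (i+1) j) := by
        rw [← mul_add, ← e]; ring
      linarith
    rw [sum_add_distrib, sum_add_distrib, ← mul_sum] at hs
    linarith
  have c2 : ∀ j ∈ range n, 3/4 * ∑ i ∈ range (n+1), (dd N (j+1) (i+1/2))^2 * (p i (j+1) - p i j)^2
      ≤ ∑ i ∈ range (n+1), (r2 i j)^2
        + ∑ i ∈ range n, ((p i (j+1) - p i j) - (p (i+1) (j+1) - p (i+1) j)) *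
          ((dd N (j+1) (i+1))^2 * -w (i+1) (j+1))
        + 1/4 * ∑ i ∈ range (n+1), (dd N (j+1) (i+1/2))^2 * (p i (j+1) - p i j)^2
        + 9 * ∑ i ∈ range (n+2), (w i (j+1))^2 := by
    intro j hj
    rw [mem_range] at hj
    have hc := col_bound n j hj N hN (fun i => p i (j+1) - p i j) (fun i => - w i (j+1))
    have hs : ∑ i ∈ range (n+1), (dd N (j+1) (i+1/2))^2 * (p i (j+1) - p i j)^2
        ≤ ∑ i ∈ range (n+1), (1/4 * ((dd N (j+1) (i+1/2))^2 * (p i (j+1) - p i j)^2) + (r2 i j)^2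
          + (dd N (j+1) (i+1/2))^2 * (p i (j+1) - p i j) * (- w (i+1) (j+1) - - w i (j+1))) := by
      refine sum_le_sum fun i hi => ?_
      rw [mem_range] at hi
      have := src_term h (dd N (j+1) (i+1/2)) (p i (j+1) - p i j) (r2 i j) (nn j hj i hi) h0
        (dd_le _ _ _ _ h0 hh)
      have e := e2 i hi j hj
      have e' : p i (j+1) - p i j = h * r2 i j + (- w (i+1) (j+1) - - w i (j+1)) := by
        rw [e]; ring
      have : (dd N (j+1) (i+1/2))^2 * (p i (j+1) - p i j)^2 =
        (dd N (j+1) (i+1/2))^2 * (p i (j+1) - p i j) * (h * r2 i j) +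
        (dd N (j+1) (i+1/2))^2 * (p i (j+1) - p i j) * (- w (i+1) (j+1) - - w i (j+1)) := by
        rw [← mul_add, ← e']; ring
      linarith
    rw [sum_add_distrib, sum_add_distrib, ← mul_sum] at hs
    simp only [neg_sq] at hc
    linarith
  have s1 := sum_le_sum c1
  have s2 := sum_le_sum c2
  simp only [sum_add_distrib, ← mul_sum] at s1 s2
  rw [← hB1] at s1
  rw [← hB2] at s2
  have canc : ∑ i ∈ range n, ∑ j ∈ range n, ((p (i+1) j - p i j) - (p (i+1) (j+1) - p i (j+1))) *
          ((dd N (i+1) (j+1))^2 * w (i+1) (j+1))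
      + ∑ j ∈ range n, ∑ i ∈ range n, ((p i (j+1) - p i j) - (p (i+1) (j+1) - p (i+1) j)) *
          ((dd N (j+1) (i+1))^2 * -w (i+1) (j+1)) = 0 := by
    rw [sum_comm (s := range n) (t := range n) (f := fun j i =>
      ((p i (j+1) - p i j) - (p (i+1) (j+1) - p (i+1) j)) *
          ((dd N (j+1) (i+1))^2 * -w (i+1) (j+1))), ← sum_add_distrib]
    refine sum_eq_zero fun i _ => ?_
    rw [← sum_add_distrib]
    refine sum_eq_zero fun j _ => ?_
    rw [dd_symm N ((j:ℝ)+1)]; ring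
  rw [hB]
  linarith

def Ea (n : ℕ) (v : ℕ → ℕ → ℝ) : ℝ :=
  ∑ j ∈ range (n+1), ∑ i ∈ range (n+1), (v (i+1) (j+1) - v i (j+1))^2

def Eb (n : ℕ) (v : ℕ → ℕ → ℝ) : ℝ :=
  ∑ i ∈ range n, ∑ j ∈ range (n+2), (v (i+1) (j+1) - v (i+1) j)^2

lemma Ea_nonneg (n : ℕ) (v : ℕ → ℕ → ℝ) : 0 ≤ Ea n v :=
  sum_nonneg fun _ _ => sum_nonneg fun _ _ => sq_nonneg _

lemma Eb_nonneg (n : ℕ) (v : ℕ → ℕ → ℝ) : 0 ≤ Eb n v :=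
  sum_nonneg fun _ _ => sum_nonneg fun _ _ => sq_nonneg _

lemma comp_energy (n : ℕ) (h : ℝ) (v q r : ℕ → ℕ → ℝ) (hv : inV1 (n+1) v)
    (eq : ∀ i < n, ∀ j < n+1,
      -(v (i+2) (j+1) - 2 * v (i+1) (j+1) + v i (j+1))
      - (v (i+1) (j+2) - 2 * v (i+1) (j+1) + v (i+1) j)
      + h * (q (i+2) (j+1) - q (i+1) (j+1)) = h^2 * r (i+1) (j+1)) :
    1/2 * (Ea n v + Eb n v) ≤ h^2 * ∑ i ∈ range n, ∑ j ∈ range (n+1), r (i+1) (j+1) * v (i+1) (j+1)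
      + h * ∑ i ∈ range (n+1), ∑ j ∈ range (n+1), q (i+1) (j+1) * (v (i+1) (j+1) - v i (j+1)) := by
  obtain ⟨v0, vN, vb, vt⟩ := hv
  have a : Ea n v = ∑ i ∈ range n, ∑ j ∈ range (n+1),
      -(v (i+2) (j+1) - 2 * v (i+1) (j+1) + v i (j+1)) * v (i+1) (j+1) := by
    rw [sum_comm]
    exact sum_congr rfl fun j _ => dir_energy (fun i => v i (j+1)) n (v0 _) (vN _)
  have b : 1/2 * Eb n v ≤ ∑ i ∈ range n, ∑ j ∈ range (n+1),
      -(v (i+1) (j+2) - 2 * v (i+1) (j+1) + v (i+1) j) * v (i+1) (j+1) := by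
    unfold Eb
    rw [mul_sum]
    exact sum_le_sum fun i _ => refl_energy (fun j => v (i+1) j) n (vb _) (vt _)
  have c : ∑ i ∈ range (n+1), ∑ j ∈ range (n+1), q (i+1) (j+1) * (v (i+1) (j+1) - v i (j+1))
      = ∑ i ∈ range n, ∑ j ∈ range (n+1), (q (i+1) (j+1) - q (i+2) (j+1)) * v (i+1) (j+1) := by
    rw [sum_comm, sum_comm (s := range n)]
    exact sum_congr rfl fun j _ => sbp (fun i => q (i+1) (j+1)) (fun i => v i (j+1)) n (v0 _) (vN _)
  have e : ∑ i ∈ range n, ∑ j ∈ range (n+1),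
      -(v (i+2) (j+1) - 2 * v (i+1) (j+1) + v i (j+1)) * v (i+1) (j+1)
      + ∑ i ∈ range n, ∑ j ∈ range (n+1),
      -(v (i+1) (j+2) - 2 * v (i+1) (j+1) + v (i+1) j) * v (i+1) (j+1)
      = h^2 * ∑ i ∈ range n, ∑ j ∈ range (n+1), r (i+1) (j+1) * v (i+1) (j+1)
      + h * ∑ i ∈ range n, ∑ j ∈ range (n+1), (q (i+1) (j+1) - q (i+2) (j+1)) * v (i+1) (j+1) := by
    rw [mul_sum, mul_sum, ← sum_add_distrib, ← sum_add_distrib]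
    refine sum_congr rfl fun i hi => ?_
    rw [mul_sum, mul_sum, ← sum_add_distrib, ← sum_add_distrib]
    refine sum_congr rfl fun j hj => ?_
    have := eq i (mem_range.1 hi) j (mem_range.1 hj)
    rw [← mul_assoc (h^2), ← this]; ring
  rw [c, ← e]
  linarith [Ea_nonneg n v]

lemma comp_poinc (n : ℕ) (v : ℕ → ℕ → ℝ) (hv : inV1 (n+1) v) :
    ∑ i ∈ range n, ∑ j ∈ range (n+1), (v (i+1) (j+1))^2 ≤ ((n:ℝ)+1)^2 * Ea n v := by
  rw [sum_comm]
  unfold Ea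
  rw [mul_sum]
  exact sum_le_sum fun j _ => poinc1 (fun i => v i (j+1)) n (hv.1 _)

/-- transverse differences over the other vertex set are controlled -/
lemma cross_bound (n : ℕ) (f : ℕ → ℕ → ℝ) (hf : inV1 (n+1) f) :
    ∑ i ∈ range n, ∑ j ∈ range (n+2), (f j (i+2) - f j (i+1))^2 ≤ Eb n f := by
  rw [sum_comm, sum_range_succ, sum_range_succ']
  simp only [hf.1, hf.2.1, sub_zero]
  have : (0:ℝ)^2 = 0 := by norm_num
  simp only [this, sum_const_zero, add_zero]
  unfold Eb
  refine sum_le_sum fun j _ => ?_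
  rw [sum_range_succ' _ (n+1), sum_range_succ _ n]
  nlinarith [sq_nonneg (f (j+1) (n+1+1) - f (j+1) (n+1)), sq_nonneg (f (j+1) (0+1) - f (j+1) 0)]

lemma omega_bound (n : ℕ) (e f : ℕ → ℕ → ℝ) (hf : inV1 (n+1) f) :
    ∑ i ∈ range n, ∑ j ∈ range (n+2),
      (e (i+1) (j+1) - e (i+1) j - (f j (i+2) - f j (i+1)))^2 ≤ 2 * Eb n e + 2 * Eb n f := by
  have hc := cross_bound n f hf
  have : ∑ i ∈ range n, ∑ j ∈ range (n+2),
      (e (i+1) (j+1) - e (i+1) j - (f j (i+2) - f j (i+1)))^2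
      ≤ ∑ i ∈ range n, ∑ j ∈ range (n+2), (2 * (e (i+1) (j+1) - e (i+1) j)^2
        + 2 * (f j (i+2) - f j (i+1))^2) := by
    refine sum_le_sum fun i _ => sum_le_sum fun j _ => ?_
    nlinarith [sq_nonneg ((e (i+1) (j+1) - e (i+1) j) + (f j (i+2) - f j (i+1)))]
  simp only [sum_add_distrib, ← mul_sum] at this
  unfold Eb at *
  linarith

lemma young2 (n m : ℕ) (a b : ℕ → ℕ → ℝ) (s t : ℝ) (hs : 0 ≤ s) (hst : 1 ≤ 4 * s * t) :
    ∑ i ∈ range n, ∑ j ∈ range m, a i j * b i j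
      ≤ s * ∑ i ∈ range n, ∑ j ∈ range m, (a i j)^2 + t * ∑ i ∈ range n, ∑ j ∈ range m, (b i j)^2 := by
  simp only [mul_sum, ← sum_add_distrib]
  refine sum_le_sum fun i _ => sum_le_sum fun j _ => ?_
  have hs' : 0 < s := by
    rcases eq_or_lt_of_le hs with h | h
    · rw [← h] at hst; norm_num at hst
    · exact h
  have h1 : 0 ≤ (2 * s * a i j - b i j)^2 := sq_nonneg _
  have h2 := mul_le_mul_of_nonneg_right hst (sq_nonneg (b i j))
  have : 4 * s * (a i j * b i j) ≤ 4 * s * (s * a i j ^2 + t * b i j ^2) := by nlinarith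
  exact le_of_mul_le_mul_left this (by linarith)

lemma core (n : ℕ) (hn : 1 ≤ n) (N h : ℝ) (hN : N = n+1) (h0 : 0 < h) (hh : h * N = 1)
    (e f ep R1 R2 R : ℕ → ℕ → ℝ) (he : inV1 (n+1) e) (hf : inV1 (n+1) f)
    (eq1 : ∀ i < n, ∀ j < n+1,
      -(e (i+2) (j+1) - 2 * e (i+1) (j+1) + e i (j+1))
      - (e (i+1) (j+2) - 2 * e (i+1) (j+1) + e (i+1) j)
      + h * (ep (i+2) (j+1) - ep (i+1) (j+1)) = h^2 * R1 (i+1) (j+1))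
    (eq2 : ∀ j < n, ∀ i < n+1,
      -(f (j+2) (i+1) - 2 * f (j+1) (i+1) + f j (i+1))
      - (f (j+1) (i+2) - 2 * f (j+1) (i+1) + f (j+1) i)
      + h * (ep (i+1) (j+2) - ep (i+1) (j+1)) = h^2 * R2 (i+1) (j+1))
    (eq3 : ∀ i < n+1, ∀ j < n+1,
      e (i+1) (j+1) - e i (j+1) + (f (j+1) (i+1) - f j (i+1)) = h * R (i+1) (j+1)) :
    ∑ i ∈ range n, ∑ j ∈ range (n+1), (e (i+1) (j+1))^2
      + ∑ j ∈ range n, ∑ i ∈ range (n+1), (f (j+1) (i+1))^2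
    ≤ 2000000 * (∑ i ∈ range n, ∑ j ∈ range (n+1), (R1 (i+1) (j+1))^2
      + ∑ j ∈ range n, ∑ i ∈ range (n+1), (R2 (i+1) (j+1))^2
      + ∑ i ∈ range (n+1), ∑ j ∈ range (n+1), (R (i+1) (j+1))^2) := by
  have en1 := comp_energy n h e ep R1 he eq1
  have en2 := comp_energy n h f (fun i j => ep j i) (fun i j => R2 j i) hf eq2
  rw [sum_comm (s := range (n+1)) (t := range (n+1))
    (f := fun i j => ep (j+1) (i+1) * (f (i+1) (j+1) - f i (j+1)))] at en2
  have epR : h * ∑ i ∈ range (n+1), ∑ j ∈ range (n+1), ep (i+1) (j+1) * (e (i+1) (j+1) - e i (j+1))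
      + h * ∑ i ∈ range (n+1), ∑ j ∈ range (n+1), ep (i+1) (j+1) * (f (j+1) (i+1) - f j (i+1))
      = h^2 * ∑ i ∈ range (n+1), ∑ j ∈ range (n+1), ep (i+1) (j+1) * R (i+1) (j+1) := by
    simp only [mul_sum, ← sum_add_distrib]
    refine sum_congr rfl fun i hi => sum_congr rfl fun j hj => ?_
    have := eq3 i (mem_range.1 hi) j (mem_range.1 hj)
    calc _ = h * ep (i+1) (j+1) * (e (i+1) (j+1) - e i (j+1) + (f (j+1) (i+1) - f j (i+1))) := by ring
      _ = _ := by rw [this]; ring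
  have R0 : ∑ i ∈ range (n+1), ∑ j ∈ range (n+1), R (i+1) (j+1) = 0 := by
    have t1 : ∑ i ∈ range (n+1), ∑ j ∈ range (n+1), (e (i+1) (j+1) - e i (j+1)) = 0 := by
      rw [sum_comm]
      refine sum_eq_zero fun j _ => ?_
      rw [sum_range_sub (fun i => e i (j+1)), he.1, he.2.1]; ring
    have t2 : ∑ i ∈ range (n+1), ∑ j ∈ range (n+1), (f (j+1) (i+1) - f j (i+1)) = 0 := by
      refine sum_eq_zero fun i _ => ?_
      rw [sum_range_sub (fun j => f j (i+1)), hf.1, hf.2.1]; ring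
    have t3 : h * ∑ i ∈ range (n+1), ∑ j ∈ range (n+1), R (i+1) (j+1) = 0 := by
      rw [← add_zero (0:ℝ)]
      nth_rewrite 1 [← t1]
      rw [← t2]
      simp only [mul_sum, ← sum_add_distrib]
      exact sum_congr rfl fun i hi => sum_congr rfl fun j hj =>
        (eq3 i (mem_range.1 hi) j (mem_range.1 hj)).symm
    exact (mul_eq_zero.1 t3).resolve_left h0.ne'
  set p : ℕ → ℕ → ℝ := fun i j => ep (i+1) (j+1) - R (i+1) (j+1) with hp
  set w : ℕ → ℕ → ℝ := fun i j => (e i (j+1) - e i j - (f j (i+1) - f j i)) / h with hw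
  have hhw : ∀ i j, h * w i j = e i (j+1) - e i j - (f j (i+1) - f j i) := by
    intro i j; simp only [hw]; field_simp
  have wg := weighted_grad n N h hN h0.le hh p (fun i j => R1 (i+1) (j+1))
    (fun i j => R2 (i+1) (j+1)) w
    (by
      intro i hi j hj
      apply mul_left_cancel₀ h0.ne'
      have a := eq1 i hi j hj
      have b := eq3 i (by omega) j hj
      have c := eq3 (i+1) (by omega) j hj
      have d1 := hhw (i+1) (j+1)
      have d2 := hhw (i+1) j
      simp only [hp]
      simp only [add_assoc, Nat.reduceAdd] at *
      linear_combination a + c - b - d1 + d2)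
    (by
      intro i hi j hj
      apply mul_left_cancel₀ h0.ne'
      have a := eq2 j hj i hi
      have b := eq3 i hi j (by omega)
      have c := eq3 i hi (j+1) (by omega)
      have d1 := hhw (i+1) (j+1)
      have d2 := hhw i (j+1)
      simp only [hp]
      simp only [add_assoc, Nat.reduceAdd] at *
      linear_combination a + c - b + d1 - d2)
  obtain ⟨c, hc⟩ := improved_poincare n hn N hN p
  have o1 : h^2 * ∑ i ∈ range n, ∑ j ∈ range (n+2), (w (i+1) j)^2 ≤ 2 * Eb n e + 2 * Eb n f := by
    refine le_trans (le_of_eq ?_) (omega_bound n e f hf)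
    simp only [mul_sum]
    refine sum_congr rfl fun i _ => sum_congr rfl fun j _ => ?_
    rw [← mul_pow, hhw]
  have o2 : h^2 * ∑ j ∈ range n, ∑ i ∈ range (n+2), (w i (j+1))^2 ≤ 2 * Eb n f + 2 * Eb n e := by
    refine le_trans (le_of_eq ?_) (omega_bound n f e he)
    simp only [mul_sum]
    refine sum_congr rfl fun i _ => sum_congr rfl fun j _ => ?_
    rw [← mul_pow, hhw]; ring
  have p1 := comp_poinc n e he
  have p2 := comp_poinc n f hf
  rw [← hN] at p1 p2
  have y1 := young2 n (n+1) (fun i j => R1 (i+1) (j+1)) (fun i j => e (i+1) (j+1)) 2 (1/8)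
    (by norm_num) (by norm_num)
  have y2 := young2 n (n+1) (fun j i => R2 (i+1) (j+1)) (fun j i => f (j+1) (i+1)) 2 (1/8)
    (by norm_num) (by norm_num)
  have y3 := young2 (n+1) (n+1) (fun i j => p i j - c) (fun i j => R (i+1) (j+1))
    (1/1440000) 360000 (by norm_num) (by norm_num)
  have dec : ∑ i ∈ range (n+1), ∑ j ∈ range (n+1), ep (i+1) (j+1) * R (i+1) (j+1)
      = ∑ i ∈ range (n+1), ∑ j ∈ range (n+1), (p i j - c) * R (i+1) (j+1)
       + ∑ i ∈ range (n+1), ∑ j ∈ range (n+1), (R (i+1) (j+1))^2 := by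
    have : c * ∑ i ∈ range (n+1), ∑ j ∈ range (n+1), R (i+1) (j+1) = 0 := by rw [R0, mul_zero]
    rw [← add_zero (∑ i ∈ range (n+1), ∑ j ∈ range (n+1), (p i j - c) * R (i+1) (j+1) + _), ← this]
    simp only [mul_sum, ← sum_add_distrib]
    refine sum_congr rfl fun i hi => sum_congr rfl fun j hj => ?_
    simp only [hp]; ring
  rw [dec] at epR
  have na := Ea_nonneg n e
  have nb := Eb_nonneg n e
  have nc := Ea_nonneg n f
  have nd := Eb_nonneg n f
  have G0 : 0 ≤ ∑ i ∈ range (n+1), ∑ j ∈ range (n+1), (R (i+1) (j+1))^2 :=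
    sum_nonneg fun _ _ => sum_nonneg fun _ _ => sq_nonneg _
  have F1 : 0 ≤ ∑ i ∈ range n, ∑ j ∈ range (n+1), (R1 (i+1) (j+1))^2 :=
    sum_nonneg fun _ _ => sum_nonneg fun _ _ => sq_nonneg _
  have F2 : 0 ≤ ∑ j ∈ range n, ∑ i ∈ range (n+1), (R2 (i+1) (j+1))^2 :=
    sum_nonneg fun _ _ => sum_nonneg fun _ _ => sq_nonneg _
  generalize Ea n e = Eae at *
  generalize Eb n e = Ebe at *
  generalize Ea n f = Eaf at *
  generalize Eb n f = Ebf at *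
  generalize Bsum n N p = B at *
  generalize ∑ i ∈ range (n+1), ∑ j ∈ range (n+1), (R (i+1) (j+1))^2 = G at *
  generalize ∑ i ∈ range n, ∑ j ∈ range (n+1), (R1 (i+1) (j+1))^2 = FF1 at *
  generalize ∑ j ∈ range n, ∑ i ∈ range (n+1), (R2 (i+1) (j+1))^2 = FF2 at *
  generalize ∑ i ∈ range n, ∑ j ∈ range (n+1), (e (i+1) (j+1))^2 = U1 at *
  generalize ∑ j ∈ range n, ∑ i ∈ range (n+1), (f (j+1) (i+1))^2 = U2 at *
  generalize ∑ i ∈ range n, ∑ j ∈ range (n+2), (w (i+1) j)^2 = O1 at *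
  generalize ∑ j ∈ range n, ∑ i ∈ range (n+2), (w i (j+1))^2 = O2 at *
  generalize ∑ i ∈ range (n+1), ∑ j ∈ range (n+1), (p i j - c)^2 = Q at *
  generalize ∑ i ∈ range (n+1), ∑ j ∈ range (n+1), (p i j - c) * R (i+1) (j+1) = Y3 at *
  generalize ∑ i ∈ range n, ∑ j ∈ range (n+1), R1 (i+1) (j+1) * e (i+1) (j+1) = Y1 at *
  generalize ∑ j ∈ range n, ∑ i ∈ range (n+1), R2 (i+1) (j+1) * f (j+1) (i+1) = Y2 at *
  have hsq : 0 < h^2 := by positivity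
  have hhN : h^2 * N^2 = 1 := by rw [← mul_pow, hh, one_pow]
  have q1 : h^2 * U1 ≤ Eae := by
    have := mul_le_mul_of_nonneg_left p1 hsq.le
    rwa [← mul_assoc, hhN, one_mul] at this
  have q2 : h^2 * U2 ≤ Eaf := by
    have := mul_le_mul_of_nonneg_left p2 hsq.le
    rwa [← mul_assoc, hhN, one_mul] at this
  have m1 := mul_le_mul_of_nonneg_left y1 hsq.le
  have m2 := mul_le_mul_of_nonneg_left y2 hsq.le
  have m3 := mul_le_mul_of_nonneg_left y3 hsq.le
  have m4 := mul_le_mul_of_nonneg_left wg hsq.le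
  have m5 := mul_le_mul_of_nonneg_left hc hsq.le
  have g0 := mul_nonneg hsq.le G0
  have g1 := mul_nonneg hsq.le F1
  have g2 := mul_nonneg hsq.le F2
  have fin : h^2 * (U1 + U2) ≤ h^2 * (2000000 * (FF1 + FF2 + G)) := by
    linarith
  exact le_of_mul_le_mul_left fin hsq

/-- discrete velocity `ℓ²`-stability:
`‖e‖ ≤ C (‖R¹‖_{V¹} + ‖R²‖_{V²} + ‖R‖_{M})` with `C` independent of `N`, where
`‖e‖² = ‖e¹‖²_{V¹} + ‖e²‖²_{V²}`. -/
theorem discrete_velocity_stability :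
    ∃ C : ℝ, 0 < C ∧ ∀ N : ℕ, 2 ≤ N →
      ∀ e1 e2 ep R1 R2 R : ℕ → ℕ → ℝ,
        inV1 N e1 → inV2 N e2 → inM N ep →
        StokesSys N e1 e2 ep R1 R2 R →
        Real.sqrt (innerV1 N e1 e1 + innerV2 N e2 e2)
          ≤ C * (Real.sqrt (innerV1 N R1 R1) + Real.sqrt (innerV2 N R2 R2)
              + Real.sqrt (innerM N R R)) := by
  refine ⟨2000, by norm_num, ?_⟩
  intro N hN2 e1 e2 ep R1 R2 R hV1 hV2 _ hS
  obtain ⟨n, rfl⟩ : ∃ n, N = n + 1 := ⟨N - 1, by omega⟩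
  obtain ⟨s1, s2, s3⟩ := hS
  have hn : 1 ≤ n := by omega
  set h := gh (n+1) with hh
  have hNpos : (0:ℝ) < (n:ℝ) + 1 := by positivity
  have hval : h = 1 / ((n:ℝ)+1) := by rw [hh, gh]; push_cast; ring
  have h0 : 0 < h := by rw [hval]; positivity
  have hhN : h * ((n:ℝ)+1) = 1 := by rw [hval]; field_simp
  have hc := core n hn ((n:ℝ)+1) h rfl h0 hhN e1 (fun i j => e2 j i) ep R1 R2 R hV1
    ⟨hV2.1, hV2.2.1, hV2.2.2.1, hV2.2.2.2⟩
    (by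
      intro i hi j hj
      have := s1 (i+1) (by simp; omega) (j+1) (by simp; omega)
      rw [← this]
      simp only [lap, d1pM, ← hh, Nat.add_sub_cancel]
      field_simp
      ring)
    (by
      intro j hj i hi
      have := s2 (i+1) (by simp; omega) (j+1) (by simp; omega)
      rw [← this]
      simp only [lap, d2pM, ← hh, Nat.add_sub_cancel]
      field_simp
      ring)
    (by
      intro i hi j hj
      have := s3 (i+1) (by simp; omega) (j+1) (by simp; omega)
      rw [← this]
      simp only [d1V1, d2V2, ← hh, Nat.add_sub_cancel]
      field_simp)
  have sh : ∀ (m : ℕ) (g : ℕ → ℝ), ∑ i ∈ Icc 1 m, g i = ∑ i ∈ range m, g (i+1) := by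
    intro m g
    rw [range_eq_Ico, sum_Ico_add' g 0 m 1]
    rfl
  have v1 : ∀ v : ℕ → ℕ → ℝ, innerV1 (n+1) v v
      = h^2 * ∑ i ∈ range n, ∑ j ∈ range (n+1), (v (i+1) (j+1))^2 := by
    intro v; simp only [innerV1, sh, ← hh, Nat.add_sub_cancel, sq]
  have v2 : ∀ v : ℕ → ℕ → ℝ, innerV2 (n+1) v v
      = h^2 * ∑ j ∈ range n, ∑ i ∈ range (n+1), (v (i+1) (j+1))^2 := by
    intro v; rw [sum_comm]; simp only [innerV2, sh, ← hh, Nat.add_sub_cancel, sq]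
  have v3 : ∀ v : ℕ → ℕ → ℝ, innerM (n+1) v v
      = h^2 * ∑ i ∈ range (n+1), ∑ j ∈ range (n+1), (v (i+1) (j+1))^2 := by
    intro v; simp only [innerM, sh, ← hh, sq]
  have hc2 := mul_le_mul_of_nonneg_left hc (sq_nonneg h)
  have key : innerV1 (n+1) e1 e1 + innerV2 (n+1) e2 e2
      ≤ 2000000 * (innerV1 (n+1) R1 R1 + innerV2 (n+1) R2 R2 + innerM (n+1) R R) := by
    rw [v1, v2, v1, v2, v3]
    linarith
  have n1 : 0 ≤ innerV1 (n+1) R1 R1 := by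
    rw [v1]; exact mul_nonneg (sq_nonneg _) (sum_nonneg fun _ _ => sum_nonneg fun _ _ => sq_nonneg _)
  have n2 : 0 ≤ innerV2 (n+1) R2 R2 := by
    rw [v2]; exact mul_nonneg (sq_nonneg _) (sum_nonneg fun _ _ => sum_nonneg fun _ _ => sq_nonneg _)
  have n3 : 0 ≤ innerM (n+1) R R := by
    rw [v3]; exact mul_nonneg (sq_nonneg _) (sum_nonneg fun _ _ => sum_nonneg fun _ _ => sq_nonneg _)
  refine Real.sqrt_le_iff.2 ⟨by positivity, key.trans ?_⟩
  have r1 := Real.sq_sqrt n1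
  have r2 := Real.sq_sqrt n2
  have r3 := Real.sq_sqrt n3
  have t1 := Real.sqrt_nonneg (innerV1 (n+1) R1 R1)
  have t2 := Real.sqrt_nonneg (innerV2 (n+1) R2 R2)
  have t3 := Real.sqrt_nonneg (innerM (n+1) R R)
  nlinarith [mul_nonneg t1 t2, mul_nonneg t1 t3, mul_nonneg t2 t3]
end
end

section
/- Second order convergence of the modified MAC scheme (discrete form of Theorem 4.1): there exists a constant C > 0, independent of N, such that for every integer N ≥ 2, every K ≥ 0, and every (e¹, e², e_p) ∈ V_h^(1) × V_h^(2) × M_h satisfying the discrete Stokes system with residuals (R¹, R², R) obeying ‖R¹‖_{V¹} ≤ K h², ‖R²‖_{V²} ≤ K h², and ‖R‖_{M} ≤ K h², one has |e|₁ ≤ C K h², ‖e‖ ≤ C K h², and ‖e_p‖_{M} ≤ C K h², where e = (e¹, e²). -/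
open Finset

noncomputable section

/-- vertical-edge weight -/
def wt1 (N i j : ℕ) : ℕ := min (min i (N - i)) (min j (N + 1 - j))

/-- horizontal-edge weight -/
def wt2 (N i j : ℕ) : ℕ := min (min i (N + 1 - i)) (min j (N - j))

/-- vertex weight -/
def wtv (N i j : ℕ) : ℕ := min (min i (N - i)) (min j (N - j))

lemma sbp_gen_s12 (F g : ℕ → ℝ) (M : ℕ) :
    ∑ i ∈ Icc 1 (M+1), g i * (F i - F (i-1)) =
      g (M+1) * F (M+1) - g 1 * F 0 - ∑ i ∈ Icc 1 M, F i * (g (i+1) - g i) := by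
  induction M with
  | zero => simp; ring
  | succ n ih =>
    rw [Finset.sum_Icc_succ_top (by omega), ih, Finset.sum_Icc_succ_top (by omega)]
    simp only [Nat.add_sub_cancel]
    ring

lemma sbp0 (F g : ℕ → ℝ) (N : ℕ) (hN : 1 ≤ N) (h0 : F 0 = 0) (h1 : F N = 0) :
    ∑ i ∈ Icc 1 N, g i * (F i - F (i-1)) = - ∑ i ∈ Icc 1 (N-1), F i * (g (i+1) - g i) := by
  obtain ⟨M, rfl⟩ : ∃ M, N = M + 1 := ⟨N-1, by omega⟩
  rw [sbp_gen_s12, h0, h1]; simp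

lemma sbp_range (r H : ℕ → ℝ) (n : ℕ) (h0 : H 0 = 0) (h1 : H n = 0) :
    ∑ j ∈ range n, r j * (H (j+1) - H j) = - ∑ j ∈ range n, H j * (r j - r (j-1)) := by
  have key : ∀ n, ∑ j ∈ range n, (r j * (H (j+1) - H j) + H j * (r j - r (j-1)))
      = r (n-1) * H n := by
    intro n
    induction n with
    | zero => simp [h0]
    | succ n ih =>
      rw [Finset.sum_range_succ, ih]; simp only [Nat.add_sub_cancel]; ring
  have := key n
  rw [h1, Finset.sum_add_distrib] at this
  linarith

lemma pt1d (u : ℕ → ℝ) (p q i k : ℕ) (hi : i ∈ Icc p q) (hk : k ∈ Icc p q) :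
    (u i - u k)^2 ≤ ((q - p : ℕ) : ℝ) * ∑ l ∈ Ico p q, (u (l+1) - u l)^2 := by
  wlog h : k ≤ i generalizing i k
  · have := this k i hk hi (by omega)
    calc _ = (u k - u i)^2 := by ring
      _ ≤ _ := this
  rw [mem_Icc] at hi hk
  rw [← Finset.sum_Ico_sub u h]
  calc _ ≤ ((Ico k i).card : ℝ) * ∑ l ∈ Ico k i, (u (l+1) - u l)^2 := sq_sum_le_card_mul_sum_sq
    _ ≤ _ := by
      apply mul_le_mul
      · simp only [Nat.card_Ico]; exact_mod_cast (by omega)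
      · apply Finset.sum_le_sum_of_subset_of_nonneg
        · apply Ico_subset_Ico <;> omega
        · intros; positivity
      · apply Finset.sum_nonneg; intros; positivity
      · positivity

lemma poincare2d (u : ℕ → ℕ → ℝ) (p q : ℕ) (hpq : p ≤ q) : ∃ c : ℝ,
    ∑ i ∈ Icc p q, ∑ j ∈ Icc p q, (u i j - c)^2 ≤ 2 * ((q + 1 - p : ℕ) : ℝ)^2 *
      (∑ i ∈ Ico p q, ∑ j ∈ Icc p q, (u (i+1) j - u i j)^2 +
       ∑ i ∈ Icc p q, ∑ j ∈ Ico p q, (u i (j+1) - u i j)^2) := by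
  set n : ℝ := ((q + 1 - p : ℕ) : ℝ) with hn
  have hcard : ((Icc p q).card : ℝ) = n := by simp [hn]
  have hqp : ((q - p : ℕ) : ℝ) ≤ n := by rw [hn]; exact_mod_cast (by omega)
  have hn0 : 0 ≤ n := by positivity
  set Y := ∑ i ∈ Icc p q, ∑ j ∈ Ico p q, (u i (j+1) - u i j)^2 with hY
  obtain ⟨i0, hi0, hle⟩ : ∃ i0 ∈ Icc p q, n * ∑ j ∈ Ico p q, (u i0 (j+1) - u i0 j)^2 ≤ Y := by
    apply Finset.exists_le_of_sum_le (s := Icc p q) ⟨p, by simp [hpq]⟩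
    rw [← Finset.mul_sum, ← hY, Finset.sum_const, nsmul_eq_mul, hcard]
  refine ⟨u i0 p, ?_⟩
  have hpt : ∀ i ∈ Icc p q, ∀ j ∈ Icc p q, (u i j - u i0 p)^2 ≤
      2 * n * ∑ l ∈ Ico p q, (u (l+1) j - u l j)^2
       + 2 * Y := by
    intro i hi j hj
    have h1 := pt1d (fun i => u i j) p q i i0 hi hi0
    have h2 := pt1d (fun j => u i0 j) p q j p hj (by simp [hpq])
    have s1 : 0 ≤ ∑ l ∈ Ico p q, (u (l+1) j - u l j)^2 := Finset.sum_nonneg fun _ _ => by positivity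
    have s2 : 0 ≤ ∑ l ∈ Ico p q, (u i0 (l+1) - u i0 l)^2 := Finset.sum_nonneg fun _ _ => by positivity
    have h3 := mul_le_mul_of_nonneg_right hqp s1
    have h4 := mul_le_mul_of_nonneg_right hqp s2
    nlinarith [sq_nonneg ((u i j - u i0 j) - (u i0 j - u i0 p))]
  calc _ ≤ ∑ i ∈ Icc p q, ∑ j ∈ Icc p q, (2 * n * ∑ l ∈ Ico p q, (u (l+1) j - u l j)^2 + 2 * Y) :=
        Finset.sum_le_sum fun i hi => Finset.sum_le_sum fun j hj => hpt i hi j hj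
    _ = _ := by
      rw [Finset.sum_comm (s := Ico p q) (t := Icc p q)]
      simp only [Finset.sum_add_distrib, Finset.sum_const, nsmul_eq_mul, hcard, ← Finset.mul_sum]
      ring

lemma divF_lower (N i j : ℕ) (hi : 1 ≤ i) (hi' : i ≤ N) (hj : 1 ≤ j) (hj' : j ≤ N) (m : ℕ)
    (hm : m = min (min i (N+1-i)) (min j (N+1-j))) :
    (N : ℝ) - 6 * m ≤ (wt1 N i j : ℝ) * (N - 2 * i) - (wt1 N (i-1) j : ℝ) * (N - 2 * (i-1 : ℕ))
      + ((wt2 N i j : ℝ) * (N - 2 * j) - (wt2 N i (j-1) : ℝ) * (N - 2 * (j-1 : ℕ))) := by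
  obtain ⟨i, rfl⟩ : ∃ k, i = k + 1 := ⟨i-1, by omega⟩
  obtain ⟨j, rfl⟩ : ∃ k, j = k + 1 := ⟨j-1, by omega⟩
  simp only [Nat.add_sub_cancel]
  obtain ⟨x, hx⟩ : ∃ x, x = wt1 N (i+1) (j+1) := ⟨_, rfl⟩
  obtain ⟨x', hx'⟩ : ∃ x, x = wt1 N i (j+1) := ⟨_, rfl⟩
  obtain ⟨y, hy⟩ : ∃ x, x = wt2 N (i+1) (j+1) := ⟨_, rfl⟩
  obtain ⟨y', hy'⟩ : ∃ x, x = wt2 N (i+1) j := ⟨_, rfl⟩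
  rw [← hx, ← hx', ← hy, ← hy']
  unfold wt1 at hx hx'
  unfold wt2 at hy hy'
  have one : ∀ k : ℕ, k + 1 ≤ N → ∃ P P' M, P = min (k+1) (N - (k+1)) ∧ P' = min k (N - k) ∧
      M = min (k+1) (N + 1 - (k+1)) ∧ P ≤ M ∧ P' ≤ M ∧
      (P = P' ∨ (P = P' + 1 ∧ 2 * (k+1) ≤ N) ∨ (P' = P + 1 ∧ N ≤ 2 * (k+1))) ∧
      (N + 1 ≤ 2 * M ∨ (P = P' + 1 ∧ P = M ∧ M = k + 1) ∨ (P' = P + 1 ∧ P' = M ∧ M + k = N)) := by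
    intro k hk
    refine ⟨_, _, _, rfl, rfl, rfl, ?_, ?_, ?_, ?_⟩ <;> omega
  obtain ⟨P, P', Mx, hP, hP', hMx, a1, a2, a3, a4⟩ := one i hi'
  obtain ⟨Q, Q', My, hQ, hQ', hMy, b1, b2, b3, b4⟩ := one j hj'
  clear one
  rw [← hP, ← hMy] at hx
  rw [← hP', ← hMy] at hx'
  rw [← hMx, ← hQ] at hy
  rw [← hMx, ← hQ'] at hy'
  rw [← hMx, ← hMy] at hm
  clear hP hP' hMx hQ hQ' hMy
  have hxm : x' ≤ m := by omega
  have hym : y' ≤ m := by omega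
  have cx : x = x' ∨ (x = x' + 1 ∧ 2 * (i+1) ≤ N) ∨ (x' = x + 1 ∧ N ≤ 2 * (i+1)) := by
    clear hy hy' b3 b4 a4 hm
    omega
  have cy : y = y' ∨ (y = y' + 1 ∧ 2 * (j+1) ≤ N) ∨ (y' = y + 1 ∧ N ≤ 2 * (j+1)) := by
    clear hx hx' a3 a4 b4 hm
    omega
  have hbig : N + 1 ≤ 2 * m ∨ (x = x' + 1 ∧ x = m ∧ m = i + 1) ∨ (x' = x + 1 ∧ x' = m ∧ m + i = N)
      ∨ (y = y' + 1 ∧ y = m ∧ m = j + 1) ∨ (y' = y + 1 ∧ y' = m ∧ m + j = N) := by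
    clear a3 b3 cx cy
    rcases le_total Mx My with h | h
    · clear hy hy' b4
      rcases a4 with h1 | ⟨h1, h2, h3⟩ | ⟨h1, h2, h3⟩
      · left; omega
      · right; left; omega
      · right; right; left; omega
    · clear hx hx' a4
      rcases b4 with h1 | ⟨h1, h2, h3⟩ | ⟨h1, h2, h3⟩
      · left; omega
      · right; right; right; left; omega
      · right; right; right; right; omega
  clear hx hx' hy hy' hm a1 a2 a3 a4 b1 b2 b3 b4
  push_cast
  have e1 : (x:ℝ) * (N - 2 * (i+1)) - x' * (N - 2 * i) = (x - x') * (N - 2 * (i+1)) - 2 * x' := by ring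
  have e2 : (y:ℝ) * (N - 2 * (j+1)) - y' * (N - 2 * j) = (y - y') * (N - 2 * (j+1)) - 2 * y' := by ring
  rw [e1, e2]
  have hxm' : (x':ℝ) ≤ m := by exact_mod_cast hxm
  have hym' : (y':ℝ) ≤ m := by exact_mod_cast hym
  have px : (0:ℝ) ≤ (x - x') * (N - 2 * (i+1)) := by
    rcases cx with rfl | ⟨rfl, h⟩ | ⟨rfl, h⟩
    · simp
    · have : (2 * (i+1) : ℝ) ≤ N := by exact_mod_cast h
      push_cast; nlinarith
    · have : (N : ℝ) ≤ 2 * (i+1) := by exact_mod_cast h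
      push_cast; nlinarith
  have py : (0:ℝ) ≤ (y - y') * (N - 2 * (j+1)) := by
    rcases cy with rfl | ⟨rfl, h⟩ | ⟨rfl, h⟩
    · simp
    · have : (2 * (j+1) : ℝ) ≤ N := by exact_mod_cast h
      push_cast; nlinarith
    · have : (N : ℝ) ≤ 2 * (j+1) := by exact_mod_cast h
      push_cast; nlinarith
  rcases hbig with h | ⟨h1, h2, h3⟩ | ⟨h1, h2, h3⟩ | ⟨h1, h2, h3⟩ | ⟨h1, h2, h3⟩
  · have : (N : ℝ) + 1 ≤ 2 * m := by exact_mod_cast h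
    linarith
  · have h1' : (x : ℝ) = x' + 1 := by exact_mod_cast h1
    have h3' : (m : ℝ) = i + 1 := by exact_mod_cast h3
    have h4 : (x - x' : ℝ) * (N - 2 * (i+1)) = N - 2 * m := by rw [h1', h3']; ring
    linarith
  · have h1' : (x' : ℝ) = x + 1 := by exact_mod_cast h1
    have h3' : (N : ℝ) = m + i := by exact_mod_cast h3.symm
    have h4 : (x - x' : ℝ) * (N - 2 * (i+1)) = N - 2 * m + 2 := by rw [h1', h3']; ring
    linarith
  · have h1' : (y : ℝ) = y' + 1 := by exact_mod_cast h1
    have h3' : (m : ℝ) = j + 1 := by exact_mod_cast h3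
    have h4 : (y - y' : ℝ) * (N - 2 * (j+1)) = N - 2 * m := by rw [h1', h3']; ring
    linarith
  · have h1' : (y' : ℝ) = y + 1 := by exact_mod_cast h1
    have h3' : (N : ℝ) = m + j := by exact_mod_cast h3.symm
    have h4 : (y - y' : ℝ) * (N - 2 * (j+1)) = N - 2 * m + 2 := by rw [h1', h3']; ring
    linarith

/-- weighted gradient energy -/
def TT (N : ℕ) (s : ℕ → ℕ → ℝ) : ℝ :=
  ∑ i ∈ Icc 1 (N-1), ∑ j ∈ Icc 1 N, ((wt1 N i j : ℝ) * (s (i+1) j - s i j))^2 +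
  ∑ i ∈ Icc 1 N, ∑ j ∈ Icc 1 (N-1), ((wt2 N i j : ℝ) * (s i (j+1) - s i j))^2

lemma shift_le (f : ℕ → ℝ) (hf : ∀ i, 0 ≤ f i) (N : ℕ) :
    ∑ i ∈ Icc 1 (N-1), (f i + f (i+1)) ≤ 2 * ∑ i ∈ Icc 1 N, f i := by
  rw [Finset.sum_add_distrib, two_mul]
  apply add_le_add
  · apply Finset.sum_le_sum_of_subset_of_nonneg
    · apply Icc_subset_Icc <;> omega
    · intros; apply hf
  · have : ∑ i ∈ Icc 1 (N-1), f (i+1) = ∑ i ∈ (Icc 1 (N-1)).map (addRightEmbedding 1), f i := by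
      rw [Finset.sum_map]; rfl
    rw [this, Finset.map_add_right_Icc]
    apply Finset.sum_le_sum_of_subset_of_nonneg
    · intro x; simp only [mem_Icc]; omega
    · intros; apply hf

lemma edge_bound (N w c : ℝ) (a b : ℝ) (hN : 0 ≤ N) (hc : |c| ≤ N) :
    -((w * c) * (b^2 - a^2)) ≤ N * (8 * (w * (b - a))^2 + (a^2 + b^2) / 16) := by
  obtain ⟨h1, h2⟩ := abs_le.mp hc
  have e : -((w * c) * (b^2 - a^2)) = (-c) * ((w * (b - a)) * (b + a)) := by ring
  rw [e]
  set p := w * (b - a)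
  have hk : ∀ t : ℝ, |t| ≤ 8 * p^2 + (a^2+b^2)/16 → (-c) * t ≤ N * (8 * p^2 + (a^2+b^2)/16) := by
    intro t ht
    calc (-c) * t ≤ |(-c) * t| := le_abs_self _
      _ = |c| * |t| := by rw [abs_mul, abs_neg]
      _ ≤ _ := mul_le_mul hc ht (abs_nonneg _) hN
  apply hk
  rw [abs_le]
  constructor <;> nlinarith [sq_nonneg (16 * p + (b + a)), sq_nonneg (16 * p - (b + a)), sq_nonneg (a - b)]

lemma F_ineq (N : ℕ) (hN : 2 ≤ N) (u : ℕ → ℕ → ℝ) :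
    ∑ i ∈ Icc 1 N, ∑ j ∈ Icc 1 N, u i j ^ 2 ≤
      16 * ∑ i ∈ Icc (N/12+1) (N - N/12), ∑ j ∈ Icc (N/12+1) (N - N/12), u i j ^ 2
        + 32 * TT N u := by
  have hNr : (2:ℝ) ≤ N := by exact_mod_cast hN
  set S := ∑ i ∈ Icc 1 N, ∑ j ∈ Icc 1 N, u i j ^ 2 with hS
  set Cr := ∑ i ∈ Icc (N/12+1) (N - N/12), ∑ j ∈ Icc (N/12+1) (N - N/12), u i j ^ 2 with hCr
  -- lower bound
  have low : (N:ℝ)/2 * S - 4 * N * Cr ≤ ∑ i ∈ Icc 1 N, ∑ j ∈ Icc 1 N, u i j ^ 2 *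
      ((wt1 N i j : ℝ) * (N - 2 * i) - (wt1 N (i-1) j : ℝ) * (N - 2 * (i-1 : ℕ))
      + ((wt2 N i j : ℝ) * (N - 2 * j) - (wt2 N i (j-1) : ℝ) * (N - 2 * (j-1 : ℕ)))) := by
    have hCr' : Cr = ∑ i ∈ Icc 1 N, ∑ j ∈ Icc 1 N,
        if (i ∈ Icc (N/12+1) (N - N/12) ∧ j ∈ Icc (N/12+1) (N - N/12)) then u i j ^2 else 0 := by
      have hsub : Icc (N/12+1) (N - N/12) ⊆ Icc 1 N := by
        apply Icc_subset_Icc <;> omega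
      rw [hCr, ← Finset.sum_subset hsub]
      · apply Finset.sum_congr rfl
        intro i hi
        rw [← Finset.sum_subset hsub]
        · apply Finset.sum_congr rfl
          intro j hj
          rw [if_pos ⟨hi, hj⟩]
        · intro j _ hj; rw [if_neg (fun h => hj h.2)]
      · intro i _ hi
        apply Finset.sum_eq_zero
        intro j _
        rw [if_neg (fun h => hi h.1)]
    rw [hCr', hS]
    simp only [Finset.mul_sum, ← Finset.sum_sub_distrib]
    apply Finset.sum_le_sum; intro i hi
    apply Finset.sum_le_sum; intro j hj
    rw [mem_Icc] at hi hj
    have hd := divF_lower N i j hi.1 hi.2 hj.1 hj.2 _ rfl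
    set D := (wt1 N i j : ℝ) * (N - 2 * i) - (wt1 N (i-1) j : ℝ) * (N - 2 * (i-1 : ℕ))
      + ((wt2 N i j : ℝ) * (N - 2 * j) - (wt2 N i (j-1) : ℝ) * (N - 2 * (j-1 : ℕ)))
    obtain ⟨m, hm⟩ : ∃ m, m = min (min i (N+1-i)) (min j (N+1-j)) := ⟨_, rfl⟩
    rw [← hm] at hd
    split_ifs with h
    · have : 2 * m ≤ N + 1 := by omega
      have : 2 * (m:ℝ) ≤ N + 1 := by exact_mod_cast this
      nlinarith [sq_nonneg (u i j)]
    · have : 12 * m ≤ N := by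
        simp only [mem_Icc] at h; omega
      have : 12 * (m:ℝ) ≤ N := by exact_mod_cast this
      nlinarith [sq_nonneg (u i j)]
  -- upper bound
  have habs : ∀ k ∈ Icc 1 N, |(N:ℝ) - 2 * k| ≤ N := by
    intro k hk
    rw [mem_Icc] at hk
    have : (k:ℝ) ≤ N := by exact_mod_cast hk.2
    have : (0:ℝ) ≤ k := by positivity
    rw [abs_le]; constructor <;> linarith
  have up1 : ∑ i ∈ Icc 1 N, ∑ j ∈ Icc 1 N, u i j ^ 2 *
      ((wt1 N i j : ℝ) * (N - 2 * i) - (wt1 N (i-1) j : ℝ) * (N - 2 * (i-1 : ℕ))) ≤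
      N * (8 * ∑ i ∈ Icc 1 (N-1), ∑ j ∈ Icc 1 N, ((wt1 N i j : ℝ) * (u (i+1) j - u i j))^2 + S / 8) := by
    rw [hS, Finset.sum_comm, Finset.sum_comm (s := Icc 1 (N-1)), Finset.sum_comm (s := Icc 1 N) (t := Icc 1 N) (f := fun i j => u i j ^2), Finset.sum_div, Finset.mul_sum, ← Finset.sum_add_distrib, Finset.mul_sum]
    apply Finset.sum_le_sum; intro j hj
    rw [sbp0 (fun i => (wt1 N i j : ℝ) * (N - 2 * i)) (fun i => u i j ^ 2) N (by omega) (by simp [wt1]) (by simp [wt1]),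
      ← Finset.sum_neg_distrib]
    calc _ ≤ ∑ i ∈ Icc 1 (N-1), (N:ℝ) * (8 * ((wt1 N i j : ℝ) * (u (i+1) j - u i j))^2 + (u i j^2 + u (i+1) j^2)/16) := by
          apply Finset.sum_le_sum; intro i hi
          apply edge_bound _ _ _ _ _ (by positivity) (habs i (by simp only [mem_Icc] at hi ⊢; omega))
      _ ≤ _ := by
          rw [← Finset.mul_sum, Finset.sum_add_distrib, ← Finset.mul_sum, ← Finset.sum_div]
          have := shift_le (fun i => u i j ^2) (fun i => sq_nonneg _) N
          apply mul_le_mul_of_nonneg_left _ (by positivity)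
          linarith
  have up2 : ∑ i ∈ Icc 1 N, ∑ j ∈ Icc 1 N, u i j ^ 2 *
      ((wt2 N i j : ℝ) * (N - 2 * j) - (wt2 N i (j-1) : ℝ) * (N - 2 * (j-1 : ℕ))) ≤
      N * (8 * ∑ i ∈ Icc 1 N, ∑ j ∈ Icc 1 (N-1), ((wt2 N i j : ℝ) * (u i (j+1) - u i j))^2 + S / 8) := by
    rw [hS, Finset.sum_div, Finset.mul_sum, ← Finset.sum_add_distrib, Finset.mul_sum]
    apply Finset.sum_le_sum; intro i hi
    rw [sbp0 (fun j => (wt2 N i j : ℝ) * (N - 2 * j)) (fun j => u i j ^ 2) N (by omega) (by simp [wt2]) (by simp [wt2]),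
      ← Finset.sum_neg_distrib]
    calc _ ≤ ∑ j ∈ Icc 1 (N-1), (N:ℝ) * (8 * ((wt2 N i j : ℝ) * (u i (j+1) - u i j))^2 + (u i j^2 + u i (j+1)^2)/16) := by
          apply Finset.sum_le_sum; intro j hj
          apply edge_bound _ _ _ _ _ (by positivity) (habs j (by simp only [mem_Icc] at hj ⊢; omega))
      _ ≤ _ := by
          rw [← Finset.mul_sum, Finset.sum_add_distrib, ← Finset.mul_sum, ← Finset.sum_div]
          have := shift_le (fun j => u i j ^2) (fun i => sq_nonneg _) N
          apply mul_le_mul_of_nonneg_left _ (by positivity)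
          linarith
  simp only [mul_add (u _ _ ^2), Finset.sum_add_distrib] at low
  have hT : TT N u = _ := rfl
  unfold TT at hT
  have fin : (N:ℝ) * (S/4) ≤ N * (4 * Cr + 8 * TT N u) := by
    unfold TT
    linarith
  have := le_of_mul_le_mul_left fin (by linarith)
  linarith

lemma improved_poincare_s12 (N : ℕ) (hN : 2 ≤ N) (s : ℕ → ℕ → ℝ)
    (h0 : ∑ i ∈ Icc 1 N, ∑ j ∈ Icc 1 N, s i j = 0) :
    ∑ i ∈ Icc 1 N, ∑ j ∈ Icc 1 N, s i j ^ 2 ≤ 4640 * TT N s := by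
  set a := N / 12 with ha
  obtain ⟨c, hc⟩ := poincare2d s (a+1) (N-a) (by omega)
  have hF := F_ineq N hN (fun i j => s i j - c)
  have hTT : TT N (fun i j => s i j - c) = TT N s := by
    unfold TT; simp
  rw [hTT, ← ha] at hF
  have hn1 : ((N - a + 1 - (a+1) : ℕ) : ℝ) ≤ 12 * (a+1 : ℕ) := by
    exact_mod_cast (by omega)
  have key : ∀ w : ℕ, a + 1 ≤ w → ∀ x : ℝ,
      ((N - a + 1 - (a+1) : ℕ) : ℝ)^2 * x^2 ≤ 144 * ((w:ℝ) * x)^2 := by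
    intro w hw x
    have h1 : ((N - a + 1 - (a+1) : ℕ) : ℝ) ≤ 12 * w := by
      exact_mod_cast (by omega)
    have h2 := mul_self_le_mul_self (by positivity) h1
    nlinarith [sq_nonneg x]
  have hcore : ∑ i ∈ Icc (a+1) (N-a), ∑ j ∈ Icc (a+1) (N-a), (s i j - c)^2 ≤ 288 * TT N s := by
    refine hc.trans ?_
    have t1 : ((N - a + 1 - (a+1) : ℕ) : ℝ)^2 * ∑ i ∈ Ico (a+1) (N-a), ∑ j ∈ Icc (a+1) (N-a), (s (i+1) j - s i j)^2
        ≤ 144 * ∑ i ∈ Icc 1 (N-1), ∑ j ∈ Icc 1 N, ((wt1 N i j : ℝ) * (s (i+1) j - s i j))^2 := by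
      simp only [Finset.mul_sum]
      calc _ ≤ ∑ i ∈ Ico (a+1) (N-a), ∑ j ∈ Icc (a+1) (N-a), 144 * ((wt1 N i j : ℝ) * (s (i+1) j - s i j))^2 := by
            apply Finset.sum_le_sum; intro i hi
            apply Finset.sum_le_sum; intro j hj
            rw [mem_Ico] at hi; rw [mem_Icc] at hj
            exact key _ (by unfold wt1; omega) _
        _ ≤ ∑ i ∈ Ico (a+1) (N-a), ∑ j ∈ Icc 1 N, 144 * ((wt1 N i j : ℝ) * (s (i+1) j - s i j))^2 := by
            apply Finset.sum_le_sum; intro i hi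
            apply Finset.sum_le_sum_of_subset_of_nonneg
            · apply Icc_subset_Icc <;> omega
            · intros; positivity
        _ ≤ _ := by
            apply Finset.sum_le_sum_of_subset_of_nonneg
            · intro i; simp only [mem_Ico, mem_Icc]; omega
            · intros; apply Finset.sum_nonneg; intros; positivity
    have t2 : ((N - a + 1 - (a+1) : ℕ) : ℝ)^2 * ∑ i ∈ Icc (a+1) (N-a), ∑ j ∈ Ico (a+1) (N-a), (s i (j+1) - s i j)^2
        ≤ 144 * ∑ i ∈ Icc 1 N, ∑ j ∈ Icc 1 (N-1), ((wt2 N i j : ℝ) * (s i (j+1) - s i j))^2 := by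
      simp only [Finset.mul_sum]
      calc _ ≤ ∑ i ∈ Icc (a+1) (N-a), ∑ j ∈ Ico (a+1) (N-a), 144 * ((wt2 N i j : ℝ) * (s i (j+1) - s i j))^2 := by
            apply Finset.sum_le_sum; intro i hi
            apply Finset.sum_le_sum; intro j hj
            rw [mem_Ico] at hj; rw [mem_Icc] at hi
            exact key _ (by unfold wt2; omega) _
        _ ≤ ∑ i ∈ Icc (a+1) (N-a), ∑ j ∈ Icc 1 (N-1), 144 * ((wt2 N i j : ℝ) * (s i (j+1) - s i j))^2 := by
            apply Finset.sum_le_sum; intro i hi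
            apply Finset.sum_le_sum_of_subset_of_nonneg
            · intro i; simp only [mem_Ico, mem_Icc]; omega
            · intros; positivity
        _ ≤ _ := by
            apply Finset.sum_le_sum_of_subset_of_nonneg
            · apply Icc_subset_Icc <;> omega
            · intros; apply Finset.sum_nonneg; intros; positivity
    unfold TT
    linarith
  have hmean : ∑ i ∈ Icc 1 N, ∑ j ∈ Icc 1 N, s i j ^ 2 ≤ ∑ i ∈ Icc 1 N, ∑ j ∈ Icc 1 N, (s i j - c) ^ 2 := by
    have : ∀ i j, (s i j - c)^2 = s i j ^2 - 2 * c * s i j + c^2 := by intros; ring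
    simp only [this, Finset.sum_add_distrib, Finset.sum_sub_distrib, ← Finset.mul_sum, h0]
    have : 0 ≤ ∑ i ∈ Icc 1 N, ∑ j ∈ Icc 1 N, c^2 :=
      Finset.sum_nonneg fun _ _ => Finset.sum_nonneg fun _ _ => sq_nonneg c
    linarith
  linarith

lemma weight_diff (w k : ℕ) (h1 : w ≤ k + 1) (h2 : k ≤ w + 1) (h3 : w = 0 → k = 0) (x : ℝ) :
    ((w:ℝ)^2 * x - (k:ℝ)^2 * x)^2 ≤ 9 * ((w:ℝ) * x)^2 := by
  rcases Nat.eq_zero_or_pos w with h | h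
  · rw [h3 h, h]; simp
  · have h1' : (w:ℝ) ≤ k + 1 := by exact_mod_cast h1
    have h2' : (k:ℝ) ≤ w + 1 := by exact_mod_cast h2
    have h3' : (1:ℝ) ≤ w := by exact_mod_cast h
    have hk : (0:ℝ) ≤ k := by positivity
    have a : |(w:ℝ)^2 - (k:ℝ)^2| ≤ |3 * (w:ℝ)| := by
      rw [abs_of_nonneg (by positivity : (0:ℝ) ≤ 3 * w), abs_le]
      constructor <;> nlinarith
    have b := sq_le_sq.mpr a
    have : ((w:ℝ)^2 * x - (k:ℝ)^2 * x)^2 = ((w:ℝ)^2 - (k:ℝ)^2)^2 * x^2 := by ring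
    rw [this]
    nlinarith [sq_nonneg x]

lemma Icc_to_range1 (N : ℕ) (f : ℕ → ℕ → ℝ) (hf : ∀ i j, (i = 0 ∨ i = N ∨ j = 0) → f i j = 0) :
    ∑ i ∈ Icc 1 (N-1), ∑ j ∈ Icc 1 N, f i j = ∑ i ∈ range (N+1), ∑ j ∈ range (N+1), f i j := by
  rw [← Finset.sum_subset (s₁ := Icc 1 (N-1)) (s₂ := range (N+1))]
  · apply Finset.sum_congr rfl; intro i _
    apply Finset.sum_subset
    · intro x; simp only [mem_Icc, mem_range]; omega
    · intro x; simp only [mem_Icc, mem_range]; intro h1 h2; apply hf; omega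
  · intro x; simp only [mem_Icc, mem_range]; omega
  · intro x; simp only [mem_Icc, mem_range]; intro h1 h2
    apply Finset.sum_eq_zero; intro j _; apply hf; omega

lemma Icc_to_range2 (N : ℕ) (f : ℕ → ℕ → ℝ) (hf : ∀ i j, (j = 0 ∨ j = N ∨ i = 0) → f i j = 0) :
    ∑ i ∈ Icc 1 N, ∑ j ∈ Icc 1 (N-1), f i j = ∑ i ∈ range (N+1), ∑ j ∈ range (N+1), f i j := by
  rw [Finset.sum_comm, Finset.sum_comm (s := range (N+1))]
  exact Icc_to_range1 N (fun j i => f i j) (fun j i h => hf i j h)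

lemma shift_range (f : ℕ → ℝ) (n : ℕ) (h0 : f 0 = 0) (h1 : f n = 0) :
    ∑ j ∈ range n, f (j+1) = ∑ j ∈ range n, f j := by
  have := Finset.sum_range_succ f n
  rw [Finset.sum_range_succ'] at this
  linarith

lemma cacc (N : ℕ) (s r g1 g2 : ℕ → ℕ → ℝ)
    (h1 : ∀ i ∈ Icc 1 (N-1), ∀ j ∈ Icc 1 N, s (i+1) j - s i j = g1 i j - (r i j - r i (j-1)))
    (h2 : ∀ i ∈ Icc 1 N, ∀ j ∈ Icc 1 (N-1), s i (j+1) - s i j = g2 i j + (r i j - r (i-1) j)) :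
    TT N s ≤ 2 * (N:ℝ)^2 * (∑ i ∈ Icc 1 (N-1), ∑ j ∈ Icc 1 N, g1 i j ^2
        + ∑ i ∈ Icc 1 N, ∑ j ∈ Icc 1 (N-1), g2 i j ^2)
      + 144 * ∑ i ∈ range (N+1), ∑ j ∈ range (N+1), r i j ^2 := by
  set H1 : ℕ → ℕ → ℝ := fun i j => (wt1 N i j : ℝ)^2 * (s (i+1) j - s i j) with hH1
  set H2 : ℕ → ℕ → ℝ := fun i j => (wt2 N i j : ℝ)^2 * (s i (j+1) - s i j) with hH2
  set P : ℕ → ℕ → ℝ := fun i j => ((wt1 N i j : ℝ) * (s (i+1) j - s i j))^2 with hP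
  set Q : ℕ → ℕ → ℝ := fun i j => ((wt2 N i j : ℝ) * (s i (j+1) - s i j))^2 with hQ
  have z1 : ∀ i j, (i = 0 ∨ i = N ∨ j = 0 ∨ j = N + 1) → wt1 N i j = 0 := by
    intro i j h; unfold wt1; omega
  have z2 : ∀ i j, (j = 0 ∨ j = N ∨ i = 0 ∨ i = N + 1) → wt2 N i j = 0 := by
    intro i j h; unfold wt2; omega
  have hT : TT N s = ∑ i ∈ Icc 1 (N-1), ∑ j ∈ Icc 1 N, P i j + ∑ i ∈ Icc 1 N, ∑ j ∈ Icc 1 (N-1), Q i j := rfl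
  have hPr : ∑ i ∈ Icc 1 (N-1), ∑ j ∈ Icc 1 N, P i j = ∑ i ∈ range (N+1), ∑ j ∈ range (N+1), P i j := by
    apply Icc_to_range1; intro i j h; simp [hP, z1 i j (by omega)]
  have hQr : ∑ i ∈ Icc 1 N, ∑ j ∈ Icc 1 (N-1), Q i j = ∑ i ∈ range (N+1), ∑ j ∈ range (N+1), Q i j := by
    apply Icc_to_range2; intro i j h; simp [hQ, z2 i j (by omega)]
  have a1 : ∑ i ∈ Icc 1 (N-1), ∑ j ∈ Icc 1 N, H1 i j * (r i j - r i (j-1))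
      = - ∑ i ∈ range (N+1), ∑ j ∈ range (N+1), r i j * (H1 i (j+1) - H1 i j) := by
    rw [Icc_to_range1 N (fun i j => H1 i j * (r i j - r i (j-1)))
      (by intro i j h; simp [hH1, z1 i j (by omega)]), ← Finset.sum_neg_distrib]
    apply Finset.sum_congr rfl; intro i _
    rw [sbp_range (fun j => r i j) (fun j => H1 i j) (N+1) (by simp [hH1, z1 i 0]) (by simp [hH1, z1 i (N+1)]), neg_neg]
  have a2 : ∑ i ∈ Icc 1 N, ∑ j ∈ Icc 1 (N-1), H2 i j * (r i j - r (i-1) j)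
      = - ∑ i ∈ range (N+1), ∑ j ∈ range (N+1), r i j * (H2 (i+1) j - H2 i j) := by
    rw [Icc_to_range2 N (fun i j => H2 i j * (r i j - r (i-1) j))
      (by intro i j h; simp [hH2, z2 i j (by omega)]), Finset.sum_comm, Finset.sum_comm (s := range (N+1)) (f := fun i j => r i j * (H2 (i+1) j - H2 i j)), ← Finset.sum_neg_distrib]
    apply Finset.sum_congr rfl; intro j _
    rw [sbp_range (fun i => r i j) (fun i => H2 i j) (N+1) (by simp [hH2, z2 0 j]) (by simp [hH2, z2 (N+1) j]), neg_neg]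
  have b1 : ∑ i ∈ Icc 1 (N-1), ∑ j ∈ Icc 1 N, P i j ≤
      ∑ i ∈ Icc 1 (N-1), ∑ j ∈ Icc 1 N, (P i j / 4 + (N:ℝ)^2 * g1 i j ^2 - H1 i j * (r i j - r i (j-1))) := by
    apply Finset.sum_le_sum; intro i hi
    apply Finset.sum_le_sum; intro j hj
    have e := h1 i hi j hj
    have hw : (wt1 N i j : ℝ) ≤ N := by
      have : wt1 N i j ≤ N := by unfold wt1; omega
      exact_mod_cast this
    have hw2 := mul_self_le_mul_self (by positivity) hw
    have e2 : r i j - r i (j-1) = g1 i j - (s (i+1) j - s i j) := by linarith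
    simp only [hP, hH1]
    rw [e2]
    generalize (s (i+1) j - s i j) = X
    nlinarith [sq_nonneg ((wt1 N i j : ℝ) * X / 2 - wt1 N i j * g1 i j), mul_le_mul_of_nonneg_right hw2 (sq_nonneg (g1 i j))]
  have b2 : ∑ i ∈ Icc 1 N, ∑ j ∈ Icc 1 (N-1), Q i j ≤
      ∑ i ∈ Icc 1 N, ∑ j ∈ Icc 1 (N-1), (Q i j / 4 + (N:ℝ)^2 * g2 i j ^2 + H2 i j * (r i j - r (i-1) j)) := by
    apply Finset.sum_le_sum; intro i hi
    apply Finset.sum_le_sum; intro j hj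
    have e := h2 i hi j hj
    have hw : (wt2 N i j : ℝ) ≤ N := by
      have : wt2 N i j ≤ N := by unfold wt2; omega
      exact_mod_cast this
    have hw2 := mul_self_le_mul_self (by positivity) hw
    have e2 : r i j - r (i-1) j = (s i (j+1) - s i j) - g2 i j := by linarith
    simp only [hQ, hH2]
    rw [e2]
    generalize (s i (j+1) - s i j) = X
    nlinarith [sq_nonneg ((wt2 N i j : ℝ) * X / 2 - wt2 N i j * g2 i j), mul_le_mul_of_nonneg_right hw2 (sq_nonneg (g2 i j))]
  simp only [Finset.sum_add_distrib, Finset.sum_sub_distrib, ← Finset.sum_div, ← Finset.mul_sum] at b1 b2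
  rw [a1] at b1
  rw [a2] at b2
  have c : ∑ i ∈ range (N+1), ∑ j ∈ range (N+1), r i j * (H1 i (j+1) - H1 i j)
      - ∑ i ∈ range (N+1), ∑ j ∈ range (N+1), r i j * (H2 (i+1) j - H2 i j) ≤
      72 * ∑ i ∈ range (N+1), ∑ j ∈ range (N+1), r i j ^2
      + 1/8 * (∑ i ∈ range (N+1), ∑ j ∈ range (N+1), P i (j+1) + ∑ i ∈ range (N+1), ∑ j ∈ range (N+1), P i j
        + ∑ i ∈ range (N+1), ∑ j ∈ range (N+1), Q (i+1) j + ∑ i ∈ range (N+1), ∑ j ∈ range (N+1), Q i j) := by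
    simp only [Finset.mul_sum, ← Finset.sum_add_distrib, ← Finset.sum_sub_distrib]
    apply Finset.sum_le_sum; intro i hi
    apply Finset.sum_le_sum; intro j hj
    rw [mem_range] at hi hj
    have k1 := weight_diff (wt1 N i (j+1)) (wtv N i j) (by unfold wt1 wtv; omega) (by unfold wt1 wtv; omega)
      (by unfold wt1 wtv; omega) (s (i+1) (j+1) - s i (j+1))
    have k2 := weight_diff (wt1 N i j) (wtv N i j) (by unfold wt1 wtv; omega) (by unfold wt1 wtv; omega)
      (by unfold wt1 wtv; omega) (s (i+1) j - s i j)
    have k3 := weight_diff (wt2 N (i+1) j) (wtv N i j) (by unfold wt2 wtv; omega) (by unfold wt2 wtv; omega)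
      (by unfold wt2 wtv; omega) (s (i+1) (j+1) - s (i+1) j)
    have k4 := weight_diff (wt2 N i j) (wtv N i j) (by unfold wt2 wtv; omega) (by unfold wt2 wtv; omega)
      (by unfold wt2 wtv; omega) (s i (j+1) - s i j)
    have hG : (H1 i (j+1) - H1 i j) - (H2 (i+1) j - H2 i j) =
      ((wt1 N i (j+1) : ℝ)^2 * (s (i+1) (j+1) - s i (j+1)) - (wtv N i j:ℝ)^2 * (s (i+1) (j+1) - s i (j+1)))
      - ((wt1 N i j : ℝ)^2 * (s (i+1) j - s i j) - (wtv N i j:ℝ)^2 * (s (i+1) j - s i j))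
      - ((wt2 N (i+1) j : ℝ)^2 * (s (i+1) (j+1) - s (i+1) j) - (wtv N i j:ℝ)^2 * (s (i+1) (j+1) - s (i+1) j))
      + ((wt2 N i j : ℝ)^2 * (s i (j+1) - s i j) - (wtv N i j:ℝ)^2 * (s i (j+1) - s i j)) := by
      simp only [hH1, hH2]; ring
    rw [← mul_sub, hG]
    simp only [hP, hQ]
    revert k1 k2 k3 k4
    generalize ((wt1 N i (j+1) : ℝ)^2 * (s (i+1) (j+1) - s i (j+1)) - (wtv N i j:ℝ)^2 * (s (i+1) (j+1) - s i (j+1))) = A1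
    generalize ((wt1 N i j : ℝ)^2 * (s (i+1) j - s i j) - (wtv N i j:ℝ)^2 * (s (i+1) j - s i j)) = A2
    generalize ((wt2 N (i+1) j : ℝ)^2 * (s (i+1) (j+1) - s (i+1) j) - (wtv N i j:ℝ)^2 * (s (i+1) (j+1) - s (i+1) j)) = A3
    generalize ((wt2 N i j : ℝ)^2 * (s i (j+1) - s i j) - (wtv N i j:ℝ)^2 * (s i (j+1) - s i j)) = A4
    intro k1 k2 k3 k4
    have q1 : ∀ A : ℝ, r i j * A ≤ 18 * r i j ^ 2 + A^2/72 := by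
      intro A; nlinarith [sq_nonneg (36 * r i j - A)]
    have := q1 A1
    have := q1 (-A2)
    have := q1 (-A3)
    have := q1 A4
    have : r i j * (A1 - A2 - A3 + A4) = r i j * A1 + r i j * (-A2) + r i j * (-A3) + r i j * A4 := by ring
    rw [this]
    simp only [neg_sq] at *
    linarith
  have s1 : ∑ i ∈ range (N+1), ∑ j ∈ range (N+1), P i (j+1) = ∑ i ∈ range (N+1), ∑ j ∈ range (N+1), P i j := by
    apply Finset.sum_congr rfl; intro i _
    exact shift_range (fun j => P i j) (N+1) (by simp [hP, z1 i 0]) (by simp [hP, z1 i (N+1)])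
  have s2 : ∑ i ∈ range (N+1), ∑ j ∈ range (N+1), Q (i+1) j = ∑ i ∈ range (N+1), ∑ j ∈ range (N+1), Q i j := by
    exact shift_range (fun i => ∑ j ∈ range (N+1), Q i j) (N+1) (by simp [hQ, z2 0]) (by simp [hQ, z2 (N+1)])
  rw [s1, s2, ← hPr, ← hQr] at c
  rw [hT]
  linarith

lemma gh_pos (N : ℕ) (hN : 2 ≤ N) : 0 < gh N := by
  unfold gh
  have : (2:ℝ) ≤ N := by exact_mod_cast hN
  positivity

lemma gh_mul (N : ℕ) (hN : 2 ≤ N) : gh N * N = 1 := by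
  unfold gh
  have : (2:ℝ) ≤ N := by exact_mod_cast hN
  field_simp

lemma ghost1d (N : ℕ) (hN : 2 ≤ N) (v : ℕ → ℝ) (h0 : v 0 = - v 1) (h1 : v (N+1) = - v N) :
    ∑ j ∈ Icc 1 N, v j * (v (j+1) - 2 * v j + v (j-1)) =
      - ∑ j ∈ Icc 0 N, rho N j * ((v (j+1) - v j) * (v (j+1) - v j)) := by
  obtain ⟨M, rfl⟩ : ∃ M, N = M + 1 := ⟨N-1, by omega⟩
  have e : ∑ j ∈ Icc 1 (M+1), v j * (v (j+1) - 2 * v j + v (j-1)) =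
      ∑ j ∈ Icc 1 (M+1), v j * ((fun k => v (k+1) - v k) j - (fun k => v (k+1) - v k) (j-1)) := by
    apply Finset.sum_congr rfl
    intro j hj
    rw [mem_Icc] at hj
    obtain ⟨k, rfl⟩ : ∃ k, j = k + 1 := ⟨j-1, by omega⟩
    simp only [Nat.add_sub_cancel]; ring
  rw [e, sbp_gen_s12, Finset.sum_Icc_succ_top (by omega), ← Finset.add_sum_Ioc_eq_sum_Icc (by omega : 0 ≤ M)]
  have e2 : ∑ j ∈ Ioc 0 M, rho (M+1) j * ((v (j+1) - v j) * (v (j+1) - v j)) =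
      ∑ j ∈ Icc 1 M, (v (j+1) - v j) * (v (j+1) - v j) := by
    apply Finset.sum_congr
    · ext x; simp only [mem_Ioc, mem_Icc]; omega
    · intro j hj
      rw [mem_Icc] at hj
      unfold rho
      rw [if_neg (by omega)]; ring
  rw [e2]
  have r0 : rho (M+1) 0 = 1/2 := by simp [rho]
  have r1 : rho (M+1) (M+1) = 1/2 := by simp [rho]
  rw [r0, r1, h1]
  simp only [zero_add]
  rw [h0]
  ring

lemma innerM_d (N : ℕ) (hN : 2 ≤ N) (v : ℕ → ℕ → ℝ) :
    innerM N (d1V1 N v) (d1V1 N v) = ∑ i ∈ Icc 1 N, ∑ j ∈ Icc 1 N, (v i j - v (i-1) j)^2 := by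
  have h := gh_pos N hN
  unfold innerM d1V1
  simp only [Finset.mul_sum]
  refine Finset.sum_congr rfl fun i _ => Finset.sum_congr rfl fun j _ => ?_
  field_simp

lemma innerW1_d (N : ℕ) (hN : 2 ≤ N) (v : ℕ → ℕ → ℝ) :
    innerW1 N (d2V1 N v) (d2V1 N v) = ∑ i ∈ Icc 1 (N-1), ∑ j ∈ Icc 0 N,
      rho N j * ((v i (j+1) - v i j) * (v i (j+1) - v i j)) := by
  have h := gh_pos N hN
  unfold innerW1 d2V1
  simp only [Finset.mul_sum]
  refine Finset.sum_congr rfl fun i _ => Finset.sum_congr rfl fun j _ => ?_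
  field_simp

lemma energy1 (N : ℕ) (hN : 2 ≤ N) (v p R : ℕ → ℕ → ℝ) (hv : inV1 N v)
    (hs : ∀ i ∈ Icc 1 (N-1), ∀ j ∈ Icc 1 N, -lap N v i j + d1pM N p i j = R i j) :
    innerM N (d1V1 N v) (d1V1 N v) + innerW1 N (d2V1 N v) (d2V1 N v)
      = innerV1 N R v + innerM N p (d1V1 N v) := by
  have h := gh_pos N hN
  obtain ⟨v0, vN, g0, gN⟩ := hv
  have eR : innerV1 N R v = ∑ i ∈ Icc 1 (N-1), ∑ j ∈ Icc 1 N,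
      ( -(v i j * ((v (i+1) j - v i j) - (v i j - v (i-1) j)))
        - v i j * (v i (j+1) - 2 * v i j + v i (j-1))
        + gh N * (v i j * (p (i+1) j - p i j))) := by
    unfold innerV1
    simp only [Finset.mul_sum]
    refine Finset.sum_congr rfl fun i hi => Finset.sum_congr rfl fun j hj => ?_
    rw [← hs i hi j hj]
    unfold lap d1pM
    field_simp
    ring
  have ep : innerM N p (d1V1 N v) = gh N * ∑ i ∈ Icc 1 N, ∑ j ∈ Icc 1 N, p i j * (v i j - v (i-1) j) := by
    unfold innerM d1V1
    simp only [Finset.mul_sum]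
    refine Finset.sum_congr rfl fun i _ => Finset.sum_congr rfl fun j _ => ?_
    field_simp
  have x1 : ∑ i ∈ Icc 1 (N-1), ∑ j ∈ Icc 1 N, v i j * ((v (i+1) j - v i j) - (v i j - v (i-1) j))
      = - ∑ i ∈ Icc 1 N, ∑ j ∈ Icc 1 N, (v i j - v (i-1) j)^2 := by
    rw [Finset.sum_comm, Finset.sum_comm (s := Icc 1 N) (f := fun i j => (v i j - v (i-1) j)^2), ← Finset.sum_neg_distrib]
    refine Finset.sum_congr rfl fun j _ => ?_
    have := sbp0 (fun i => v i j) (fun i => v i j - v (i-1) j) N (by omega) (v0 j) (vN j)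
    simp only [Nat.add_sub_cancel] at this
    rw [eq_neg_iff_add_eq_zero] at this ⊢
    rw [← this, add_comm]
    congr 1
    exact Finset.sum_congr rfl fun i _ => by ring
  have x2 : ∑ i ∈ Icc 1 (N-1), ∑ j ∈ Icc 1 N, v i j * (v i (j+1) - 2 * v i j + v i (j-1))
      = - ∑ i ∈ Icc 1 (N-1), ∑ j ∈ Icc 0 N, rho N j * ((v i (j+1) - v i j) * (v i (j+1) - v i j)) := by
    rw [← Finset.sum_neg_distrib]
    refine Finset.sum_congr rfl fun i _ => ?_
    exact ghost1d N hN (fun j => v i j) (g0 i) (gN i)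
  have x3 : ∑ i ∈ Icc 1 (N-1), ∑ j ∈ Icc 1 N, v i j * (p (i+1) j - p i j)
      = - ∑ i ∈ Icc 1 N, ∑ j ∈ Icc 1 N, p i j * (v i j - v (i-1) j) := by
    rw [Finset.sum_comm, Finset.sum_comm (s := Icc 1 N) (f := fun i j => p i j * (v i j - v (i-1) j)), ← Finset.sum_neg_distrib]
    refine Finset.sum_congr rfl fun j _ => ?_
    rw [sbp0 (fun i => v i j) (fun i => p i j) N (by omega) (v0 j) (vN j), neg_neg]
  simp only [Finset.sum_add_distrib, Finset.sum_sub_distrib, Finset.sum_neg_distrib, ← Finset.mul_sum] at eR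
  rw [x1, x2, x3] at eR
  rw [innerM_d N hN, innerW1_d N hN, eR, ep]
  ring

lemma poinc1_s12 (N : ℕ) (hN : 2 ≤ N) (v : ℕ → ℕ → ℝ) (hv : inV1 N v) :
    innerV1 N v v ≤ innerM N (d1V1 N v) (d1V1 N v) := by
  have h := gh_pos N hN
  have hm := gh_mul N hN
  rw [innerM_d N hN]
  have key : ∀ i ∈ Icc 1 (N-1), ∑ j ∈ Icc 1 N, v i j * v i j ≤
      N * ∑ k ∈ Icc 1 N, ∑ j ∈ Icc 1 N, (v k j - v (k-1) j)^2 := by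
    intro i hi
    rw [mem_Icc] at hi
    rw [Finset.sum_comm, Finset.mul_sum]
    apply Finset.sum_le_sum; intro j _
    have := pt1d (fun i => v i j) 0 N i 0 (by simp; omega) (by simp)
    simp only [hv.1 j, sub_zero] at this
    have e : ∑ l ∈ Ico 0 N, (v (l+1) j - v l j)^2 = ∑ k ∈ Icc 1 N, (v k j - v (k-1) j)^2 := by
      refine Finset.sum_bij (fun l _ => l + 1) ?_ ?_ ?_ ?_
      · intro a ha; rw [mem_Ico] at ha; rw [mem_Icc]; omega
      · intro a _ b _ hab; exact Nat.succ.inj hab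
      · intro b hb; rw [mem_Icc] at hb
        exact ⟨b - 1, by rw [mem_Ico]; omega, by omega⟩
      · intro a _; rw [Nat.add_sub_cancel]
    rw [e] at this
    rw [← sq]; exact_mod_cast this
  set S := ∑ k ∈ Icc 1 N, ∑ j ∈ Icc 1 N, (v k j - v (k-1) j)^2
  have hS : 0 ≤ S := Finset.sum_nonneg fun _ _ => Finset.sum_nonneg fun _ _ => sq_nonneg _
  unfold innerV1
  calc _ ≤ gh N ^2 * ∑ i ∈ Icc 1 (N-1), (N * S) := by
        apply mul_le_mul_of_nonneg_left _ (by positivity)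
        exact Finset.sum_le_sum key
    _ = gh N^2 * (((N-1:ℕ):ℝ) * (N * S)) := by simp
    _ ≤ gh N^2 * ((N:ℝ) * (N * S)) := by
        gcongr; omega
    _ = (gh N * N)^2 * S := by ring
    _ = S := by rw [hm]; ring

/-- transpose -/
def tr (v : ℕ → ℕ → ℝ) : ℕ → ℕ → ℝ := fun i j => v j i

lemma innerM_tr (N : ℕ) (p q : ℕ → ℕ → ℝ) : innerM N (tr p) (tr q) = innerM N p q := by
  unfold innerM tr; rw [Finset.sum_comm]
lemma innerV_tr (N : ℕ) (p q : ℕ → ℕ → ℝ) : innerV1 N (tr p) (tr q) = innerV2 N p q := by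
  unfold innerV1 innerV2 tr; rw [Finset.sum_comm]
lemma innerW_tr (N : ℕ) (p q : ℕ → ℕ → ℝ) : innerW1 N (tr p) (tr q) = innerW2 N p q := by
  unfold innerW1 innerW2 tr; rw [Finset.sum_comm]
lemma inV_tr {N : ℕ} {v : ℕ → ℕ → ℝ} (hv : inV2 N v) : inV1 N (tr v) := hv
lemma d1_tr (N : ℕ) (v : ℕ → ℕ → ℝ) : d1V1 N (tr v) = tr (d2V2 N v) := rfl
lemma d2_tr (N : ℕ) (v : ℕ → ℕ → ℝ) : d2V1 N (tr v) = tr (d1V2 N v) := rfl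

lemma energy2 (N : ℕ) (hN : 2 ≤ N) (v p R : ℕ → ℕ → ℝ) (hv : inV2 N v)
    (hs : ∀ i ∈ Icc 1 N, ∀ j ∈ Icc 1 (N-1), -lap N v i j + d2pM N p i j = R i j) :
    innerM N (d2V2 N v) (d2V2 N v) + innerW2 N (d1V2 N v) (d1V2 N v)
      = innerV2 N R v + innerM N p (d2V2 N v) := by
  have := energy1 N hN (tr v) (tr p) (tr R) (inV_tr hv) (by
    intro i hi j hj
    have := hs j hj i hi
    simp only [lap, d1pM, d2pM, tr] at this ⊢
    linarith)
  simpa only [d1_tr, d2_tr, innerM_tr, innerV_tr, innerW_tr] using this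

lemma poinc2 (N : ℕ) (hN : 2 ≤ N) (v : ℕ → ℕ → ℝ) (hv : inV2 N v) :
    innerV2 N v v ≤ innerM N (d2V2 N v) (d2V2 N v) := by
  have := poinc1_s12 N hN (tr v) (inV_tr hv)
  simpa only [d1_tr, d2_tr, innerM_tr, innerV_tr, innerW_tr] using this

lemma rotbound1 (N : ℕ) (hN : 2 ≤ N) (v : ℕ → ℕ → ℝ) (hv : inV1 N v) :
    ∑ i ∈ range (N+1), ∑ j ∈ range (N+1), (v i (j+1) - v i j)^2 ≤
      2 * innerW1 N (d2V1 N v) (d2V1 N v) := by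
  rw [innerW1_d N hN, Finset.mul_sum]
  rw [← Finset.sum_subset (s₁ := Icc 1 (N-1)) (s₂ := range (N+1))]
  · apply Finset.sum_le_sum; intro i _
    rw [Finset.mul_sum]
    have : range (N+1) = Icc 0 N := by ext x; simp only [mem_range, mem_Icc]; omega
    rw [this]
    apply Finset.sum_le_sum; intro j _
    have : 1/2 ≤ rho N j := by unfold rho; split_ifs <;> norm_num
    nlinarith [sq_nonneg (v i (j+1) - v i j)]
  · intro x; simp only [mem_Icc, mem_range]; omega
  · intro x; simp only [mem_Icc, mem_range]; intro h1 h2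
    apply Finset.sum_eq_zero; intro j _
    have : x = 0 ∨ x = N := by omega
    rcases this with rfl | rfl
    · simp [hv.1]
    · simp [hv.2.1]

lemma rotbound2 (N : ℕ) (hN : 2 ≤ N) (v : ℕ → ℕ → ℝ) (hv : inV2 N v) :
    ∑ i ∈ range (N+1), ∑ j ∈ range (N+1), (v (i+1) j - v i j)^2 ≤
      2 * innerW2 N (d1V2 N v) (d1V2 N v) := by
  have := rotbound1 N hN (tr v) (inV_tr hv)
  rw [d2_tr, innerW_tr, Finset.sum_comm] at this
  exact this

lemma sum_d1_zero (N : ℕ) (hN : 2 ≤ N) (v : ℕ → ℕ → ℝ) (hv : inV1 N v) :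
    ∑ i ∈ Icc 1 N, ∑ j ∈ Icc 1 N, (v i j - v (i-1) j) = 0 := by
  rw [Finset.sum_comm]
  apply Finset.sum_eq_zero; intro j _
  have := sbp0 (fun i => v i j) (fun _ => 1) N (by omega) (hv.1 j) (hv.2.1 j)
  simpa using this

lemma pressure (N : ℕ) (hN : 2 ≤ N) (e1 e2 ep R1 R2 R : ℕ → ℕ → ℝ)
    (h1 : inV1 N e1) (h2 : inV2 N e2) (hp : inM N ep) (hs : StokesSys N e1 e2 ep R1 R2 R) :
    innerM N ep ep ≤ 9280 * (2 * (innerV1 N R1 R1 + innerV2 N R2 R2)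
      + 576 * H1semisq N e1 e2) + 2 * innerM N R R := by
  have h := gh_pos N hN
  have hm := gh_mul N hN
  obtain ⟨s1, s2, s3⟩ := hs
  set d : ℕ → ℕ → ℝ := fun i j => (e1 i j - e1 (i-1) j) + (e2 i j - e2 i (j-1)) with hd
  set s : ℕ → ℕ → ℝ := fun i j => gh N * ep i j - d i j with hsd
  set r : ℕ → ℕ → ℝ := fun i j => (e2 (i+1) j - e2 i j) - (e1 i (j+1) - e1 i j) with hr
  have hd0 : ∑ i ∈ Icc 1 N, ∑ j ∈ Icc 1 N, d i j = 0 := by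
    simp only [hd, Finset.sum_add_distrib]
    rw [sum_d1_zero N hN e1 h1, zero_add, Finset.sum_comm]
    exact sum_d1_zero N hN (tr e2) (inV_tr h2)
  have hs0 : ∑ i ∈ Icc 1 N, ∑ j ∈ Icc 1 N, s i j = 0 := by
    simp only [hsd, Finset.sum_sub_distrib, ← Finset.mul_sum, hd0]
    unfold inM at hp; rw [hp]; simp
  have hP := improved_poincare_s12 N hN s hs0
  have hC := cacc N s r (fun i j => gh N ^2 * R1 i j) (fun i j => gh N ^2 * R2 i j)
    (by
      intro i hi j hj
      have := s1 i hi j hj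
      rw [mem_Icc] at hi hj
      obtain ⟨k, rfl⟩ : ∃ k, i = k + 1 := ⟨i-1, by omega⟩
      obtain ⟨l, rfl⟩ : ∃ l, j = l + 1 := ⟨j-1, by omega⟩
      rw [← this]
      simp only [hsd, hr, hd, lap, d1pM, Nat.add_sub_cancel]
      field_simp
      ring)
    (by
      intro i hi j hj
      have := s2 i hi j hj
      rw [mem_Icc] at hi hj
      obtain ⟨k, rfl⟩ : ∃ k, i = k + 1 := ⟨i-1, by omega⟩
      obtain ⟨l, rfl⟩ : ∃ l, j = l + 1 := ⟨j-1, by omega⟩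
      rw [← this]
      simp only [hsd, hr, hd, lap, d2pM, Nat.add_sub_cancel]
      field_simp
      ring)
  have hR1 : (N:ℝ)^2 * ∑ i ∈ Icc 1 (N-1), ∑ j ∈ Icc 1 N, (gh N ^2 * R1 i j)^2 = innerV1 N R1 R1 := by
    unfold innerV1
    simp only [Finset.mul_sum]
    refine Finset.sum_congr rfl fun i _ => Finset.sum_congr rfl fun j _ => ?_
    calc _ = (gh N * N)^2 * (gh N ^2 * (R1 i j * R1 i j)) := by ring
      _ = _ := by rw [hm]; ring
  have hR2 : (N:ℝ)^2 * ∑ i ∈ Icc 1 N, ∑ j ∈ Icc 1 (N-1), (gh N ^2 * R2 i j)^2 = innerV2 N R2 R2 := by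
    unfold innerV2
    simp only [Finset.mul_sum]
    refine Finset.sum_congr rfl fun i _ => Finset.sum_congr rfl fun j _ => ?_
    calc _ = (gh N * N)^2 * (gh N ^2 * (R2 i j * R2 i j)) := by ring
      _ = _ := by rw [hm]; ring
  have hrr : ∑ i ∈ range (N+1), ∑ j ∈ range (N+1), r i j ^2 ≤ 4 * H1semisq N e1 e2 := by
    have a1 := rotbound1 N hN e1 h1
    have a2 := rotbound2 N hN e2 h2
    have a3 : ∑ i ∈ range (N+1), ∑ j ∈ range (N+1), r i j ^2 ≤
        ∑ i ∈ range (N+1), ∑ j ∈ range (N+1), (2 * (e2 (i+1) j - e2 i j)^2 + 2 * (e1 i (j+1) - e1 i j)^2) := by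
      refine Finset.sum_le_sum fun i _ => Finset.sum_le_sum fun j _ => ?_
      simp only [hr]
      nlinarith [sq_nonneg ((e2 (i+1) j - e2 i j) + (e1 i (j+1) - e1 i j))]
    simp only [Finset.sum_add_distrib, ← Finset.mul_sum] at a3
    have n1 : 0 ≤ innerM N (d1V1 N e1) (d1V1 N e1) := by
      rw [innerM_d N hN]
      exact Finset.sum_nonneg fun _ _ => Finset.sum_nonneg fun _ _ => sq_nonneg _
    have n2 : 0 ≤ innerM N (d2V2 N e2) (d2V2 N e2) := by
      rw [← innerM_tr, ← d1_tr, innerM_d N hN]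
      exact Finset.sum_nonneg fun _ _ => Finset.sum_nonneg fun _ _ => sq_nonneg _
    unfold H1semisq
    linarith
  have hfin : innerM N ep ep ≤ 2 * ∑ i ∈ Icc 1 N, ∑ j ∈ Icc 1 N, s i j ^ 2 + 2 * innerM N R R := by
    unfold innerM
    simp only [Finset.mul_sum, ← Finset.sum_add_distrib]
    refine Finset.sum_le_sum fun i hi => Finset.sum_le_sum fun j hj => ?_
    have e : d i j = gh N * R i j := by
      rw [← s3 i hi j hj]
      simp only [hd, d1V1, d2V2]
      field_simp
    have e2 : gh N * ep i j = s i j + gh N * R i j := by rw [← e]; simp [hsd]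
    have e3 : gh N ^2 * (ep i j * ep i j) = (s i j + gh N * R i j)^2 := by rw [← e2]; ring
    rw [e3]
    nlinarith [sq_nonneg (s i j - gh N * R i j)]
  have : 2 * (N:ℝ)^2 * (∑ i ∈ Icc 1 (N-1), ∑ j ∈ Icc 1 N, (gh N ^2 * R1 i j)^2
        + ∑ i ∈ Icc 1 N, ∑ j ∈ Icc 1 (N-1), (gh N ^2 * R2 i j)^2) = 2 * (innerV1 N R1 R1 + innerV2 N R2 R2) := by
    rw [← hR1, ← hR2]; ring
  rw [this] at hC
  linarith

lemma young (h : ℝ) (S T : Finset ℕ) (a b : ℕ → ℕ → ℝ) (l : ℝ) (hl : 0 < l) :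
    h^2 * ∑ i ∈ S, ∑ j ∈ T, a i j * b i j ≤
      l * (h^2 * ∑ i ∈ S, ∑ j ∈ T, a i j * a i j) + 1 / (4 * l) * (h^2 * ∑ i ∈ S, ∑ j ∈ T, b i j * b i j) := by
  simp only [Finset.mul_sum, ← Finset.sum_add_distrib]
  refine Finset.sum_le_sum fun i hi => Finset.sum_le_sum fun j hj => ?_
  have : l * (h^2 * (a i j * a i j)) + 1 / (4 * l) * (h^2 * (b i j * b i j)) - h^2 * (a i j * b i j)
    = (h * (2 * l * a i j - b i j))^2 / (4 * l) := by field_simp; ring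
  have h2 : 0 ≤ (h * (2 * l * a i j - b i j))^2 / (4 * l) := by positivity
  linarith

/-- second order convergence of the modified MAC scheme (discrete form of
Theorem 4.1): if the residuals are `O(h²)` with constant `K`, then the velocity error, its
discrete gradient, and the pressure error are all bounded by `C K h²` with `C` independent
of `N`. -/
theorem mac_second_order_convergence :
    ∃ C : ℝ, 0 < C ∧ ∀ N : ℕ, 2 ≤ N → ∀ K : ℝ, 0 ≤ K →
      ∀ e1 e2 ep R1 R2 R : ℕ → ℕ → ℝ,
        inV1 N e1 → inV2 N e2 → inM N ep →
        StokesSys N e1 e2 ep R1 R2 R →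
        Real.sqrt (innerV1 N R1 R1) ≤ K * gh N ^ 2 →
        Real.sqrt (innerV2 N R2 R2) ≤ K * gh N ^ 2 →
        Real.sqrt (innerM N R R) ≤ K * gh N ^ 2 →
        H1semi N e1 e2 ≤ C * K * gh N ^ 2 ∧
        Real.sqrt (innerV1 N e1 e1 + innerV2 N e2 e2) ≤ C * K * gh N ^ 2 ∧
        Real.sqrt (innerM N ep ep) ≤ C * K * gh N ^ 2 := by
  refine ⟨10^8, by norm_num, ?_⟩
  intro N hN K hK e1 e2 ep R1 R2 R h1 h2 hp hs hR1 hR2 hR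
  have h := gh_pos N hN
  have hk : 0 ≤ K * gh N ^ 2 := by positivity
  have hpr := pressure N hN e1 e2 ep R1 R2 R h1 h2 hp hs
  have E1 := energy1 N hN e1 ep R1 h1 hs.1
  have E2 := energy2 N hN e2 ep R2 h2 hs.2.1
  have P1 := poinc1_s12 N hN e1 h1
  have P2 := poinc2 N hN e2 h2
  have hdiv : innerM N ep (d1V1 N e1) + innerM N ep (d2V2 N e2) = innerM N ep R := by
    unfold innerM
    rw [← mul_add, ← Finset.sum_add_distrib]
    congr 1
    refine Finset.sum_congr rfl fun i hi => ?_
    rw [← Finset.sum_add_distrib]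
    refine Finset.sum_congr rfl fun j hj => ?_
    rw [← hs.2.2 i hi j hj]; ring
  have n1 : 0 ≤ innerM N (d1V1 N e1) (d1V1 N e1) := by
    rw [innerM_d N hN]
    exact Finset.sum_nonneg fun _ _ => Finset.sum_nonneg fun _ _ => sq_nonneg _
  have n2 : 0 ≤ innerM N (d2V2 N e2) (d2V2 N e2) := by
    rw [← innerM_tr, ← d1_tr, innerM_d N hN]
    exact Finset.sum_nonneg fun _ _ => Finset.sum_nonneg fun _ _ => sq_nonneg _
  have hρ : ∀ k, 0 ≤ rho N k := by intro k; unfold rho; split_ifs <;> norm_num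
  have n3 : ∀ v, 0 ≤ innerW1 N v v := by
    intro v
    unfold innerW1
    exact mul_nonneg (by positivity) (Finset.sum_nonneg fun _ _ => Finset.sum_nonneg fun _ _ =>
      mul_nonneg (hρ _) (mul_self_nonneg _))
  have n4 : 0 ≤ innerW1 N (d2V1 N e1) (d2V1 N e1) := n3 _
  have n5 : 0 ≤ innerW2 N (d1V2 N e2) (d1V2 N e2) := by rw [← innerW_tr]; exact n3 _
  have Y1 : innerV1 N R1 e1 ≤ 1 * innerV1 N R1 R1 + 1 / (4 * 1) * innerV1 N e1 e1 :=
    young _ _ _ _ _ 1 one_pos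
  have Y2 : innerV2 N R2 e2 ≤ 1 * innerV2 N R2 R2 + 1 / (4 * 1) * innerV2 N e2 e2 :=
    young _ _ _ _ _ 1 one_pos
  have Y3 : innerM N ep R ≤ 1 / 40000000 * innerM N ep ep + 1 / (4 * (1 / 40000000)) * innerM N R R :=
    young _ _ _ _ _ (1 / 40000000) (by norm_num)
  have q1 := (Real.sqrt_le_left hk).mp hR1
  have q2 := (Real.sqrt_le_left hk).mp hR2
  have q3 := (Real.sqrt_le_left hk).mp hR
  set k := K * gh N ^ 2 with hkd
  have hE : H1semisq N e1 e2 = innerM N (d1V1 N e1) (d1V1 N e1) + innerW1 N (d2V1 N e1) (d2V1 N e1)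
    + innerW2 N (d1V2 N e2) (d1V2 N e2) + innerM N (d2V2 N e2) (d2V2 N e2) := rfl
  have hC : (10:ℝ)^8 * K * gh N ^ 2 = 10^8 * k := by rw [hkd]; ring
  have hC0 : (0:ℝ) ≤ 10^8 * k := by positivity
  have hk2 : 0 ≤ k^2 := sq_nonneg k
  have main : H1semisq N e1 e2 ≤ 30000000 * k^2 := by
    norm_num at Y1 Y2 Y3
    linarith
  rw [hC]
  unfold H1semi
  refine ⟨?_, ?_, ?_⟩
  · rw [Real.sqrt_le_left hC0, mul_pow]
    linarith
  · rw [Real.sqrt_le_left hC0, mul_pow]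
    linarith
  · rw [Real.sqrt_le_left hC0, mul_pow]
    linarith
end
end
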